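/- arXiv:2402.17865 — 3 statements merged into one kernel-verified Lean document; each statement's English description precedes it below -/
import Mathlib

section
/- For every sequence of evaluation parameters a = (a_1, …, a_p) ∈ ℂ^p, the deformed Tanisaki–Garsia–Procesi algebra R_a(λ) is a finite-dimensional ℂ-vector space of dimension exactly the multinomial coefficient d! / ((λ^t_1)! ⋯ (λ^t_p)!). In particular, this dimension is independent of a. -/
open MvPolynomial

noncomputable section

/-- Complete homogeneous symmetric function `h_k` of a list of complex numbers. -/
def hcomp : ℕ → List ℂ → ℂ
  | 0, _ => 1
  | _ + 1, [] => 0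
  | k + 1, x :: l => x * hcomp k (x :: l) + hcomp (k + 1) l
  termination_by k l => (l.length, k)

/-- Elementary symmetric polynomial `e_r` in the variables indexed by `J ⊆ {1,…,d}`. -/
def elemSym (d : ℕ) (J : Finset (Fin d)) (r : ℕ) : MvPolynomial (Fin d) ℂ :=
  ∑ s ∈ J.powersetCard r, ∏ j ∈ s, X j

/-- The tuple `a^{(n)}` : entries `a_1,…,a_{λ_i}` for each row `i = n+1,…,ℓ` (0-indexed rows). -/
def aTuple (ℓ : ℕ) (lam : ℕ → ℕ) (a : ℕ → ℂ) (n : ℕ) : List ℂ :=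
  ((List.range ℓ).drop n).flatMap fun i => (List.range (lam i)).map a

/-- `m_λ(n) = λ_{n+1} + … + λ_ℓ` (0-indexed rows `n,…,ℓ-1`). -/
def mRem (ℓ : ℕ) (lam : ℕ → ℕ) (n : ℕ) : ℕ := ∑ i ∈ Finset.Ico n ℓ, lam i

/-- The deformed Tanisaki generator `g_{n,J,r} = Σ_{k=0}^r (−1)^k e_{r−k}(t_J) h_k(a^{(n)})`. -/
def tanGen (d ℓ : ℕ) (lam : ℕ → ℕ) (a : ℕ → ℂ) (n : ℕ) (J : Finset (Fin d)) (r : ℕ) :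
    MvPolynomial (Fin d) ℂ :=
  ∑ k ∈ Finset.range (r + 1), C ((-1) ^ k * hcomp k (aTuple ℓ lam a n)) * elemSym d J (r - k)

/-- The deformed Tanisaki ideal `⟨𝒞^a_λ⟩`. -/
def tanIdeal (d ℓ : ℕ) (lam : ℕ → ℕ) (a : ℕ → ℂ) : Ideal (MvPolynomial (Fin d) ℂ) :=
  Ideal.span {g | ∃ n J r, n < ℓ ∧ J.card = d - n ∧
    d - n - mRem ℓ lam n < r ∧ r ≤ d - n ∧ g = tanGen d ℓ lam a n J r}

/-- `lam 0, lam 1, …, lam (ℓ-1)` is a partition of `d` with `ℓ` positive parts. -/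
def IsPartitionOf (d ℓ : ℕ) (lam : ℕ → ℕ) : Prop :=
  0 < ℓ ∧ (∀ i j, i ≤ j → lam j ≤ lam i) ∧ (∀ i < ℓ, 0 < lam i) ∧
    (∀ i, ℓ ≤ i → lam i = 0) ∧ ∑ i ∈ Finset.range ℓ, lam i = d

/-- `λ^t_i = #{rows j with λ_j ≥ i}` (here `i ≥ 1`). -/
def lamT (ℓ : ℕ) (lam : ℕ → ℕ) (i : ℕ) : ℕ :=
  ((Finset.range ℓ).filter fun j => i ≤ lam j).card

/-- The deformed Tanisaki–Garsia–Procesi algebra `R_a(λ)`. -/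
abbrev TGPAlg (d ℓ : ℕ) (lam : ℕ → ℕ) (a : ℕ → ℂ) :=
  MvPolynomial (Fin d) ℂ ⧸ tanIdeal d ℓ lam a



/-! ### Part 1: the generators and divisibility of polynomials -/

section Plain

variable {R : Type} [CommRing R]

/-- `∏_{j ∈ J} (z - t_j)`. -/
def tPoly {σ : Type} (t : σ → R) (J : Finset σ) : Polynomial R :=
  ∏ j ∈ J, (Polynomial.X - Polynomial.C (t j))

lemma natDegree_tPoly_le {σ : Type} (t : σ → R) (J : Finset σ) :
    (tPoly t J).natDegree ≤ J.card := by
  refine (Polynomial.natDegree_prod_le _ _).trans ?_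
  refine (Finset.sum_le_card_nsmul _ _ 1 ?_).trans (by simp)
  intro j _
  exact Polynomial.natDegree_X_sub_C_le _

lemma tPoly_monic {σ : Type} (t : σ → R) (J : Finset σ) : (tPoly t J).Monic :=
  Polynomial.monic_prod_of_monic _ _ fun _ _ => Polynomial.monic_X_sub_C _

lemma reflect_X_sub_C (x : R) :
    Polynomial.reflect 1 (Polynomial.X - Polynomial.C x) = 1 - Polynomial.C x * Polynomial.X := by
  rw [Polynomial.reflect_sub, Polynomial.reflect_C, pow_one]
  congr 1
  simp

end Plain

section Criterion

variable {R : Type} [CommRing R] [Algebra ℂ R]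

/-- `∏_{a ∈ l} (z - a)`. -/
def lPoly (R : Type) [CommRing R] [Algebra ℂ R] (l : List ℂ) : Polynomial R :=
  (l.map fun x => Polynomial.X - Polynomial.C (algebraMap ℂ R x)).prod

def lRev (R : Type) [CommRing R] [Algebra ℂ R] (l : List ℂ) : Polynomial R :=
  (l.map fun x => 1 - Polynomial.C (algebraMap ℂ R x) * Polynomial.X).prod

def hSer (R : Type) [CommRing R] [Algebra ℂ R] (l : List ℂ) : PowerSeries R :=
  PowerSeries.mk fun k => algebraMap ℂ R (hcomp k l)

lemma hSer_nil : hSer R [] = 1 := by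
  ext k
  cases k <;> simp [hSer, hcomp, PowerSeries.coeff_one]

lemma hSer_cons (x : ℂ) (l : List ℂ) :
    hSer R (x :: l) * (1 - PowerSeries.C (algebraMap ℂ R x) * PowerSeries.X) = hSer R l := by
  ext k
  have : hSer R (x :: l) * (1 - PowerSeries.C (algebraMap ℂ R x) * PowerSeries.X)
      = hSer R (x :: l) - PowerSeries.C (algebraMap ℂ R x) * (hSer R (x :: l) * PowerSeries.X) := by
    ring
  rw [this, map_sub, PowerSeries.coeff_C_mul]
  cases k with
  | zero => simp [hSer, hcomp]
  | succ k =>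
    rw [PowerSeries.coeff_succ_mul_X]
    simp only [hSer, PowerSeries.coeff_mk]
    rw [hcomp]
    simp

lemma hSer_mul_lRev (l : List ℂ) : hSer R l * (lRev R l : PowerSeries R) = 1 := by
  induction l with
  | nil => simp [hSer_nil, lRev]
  | cons x l ih =>
    have : (lRev R (x :: l) : PowerSeries R) =
      (1 - PowerSeries.C (algebraMap ℂ R x) * PowerSeries.X) * (lRev R l : PowerSeries R) := by
      simp [lRev]
    rw [this, ← mul_assoc, hSer_cons, ih]

lemma natDegree_lPoly_le (l : List ℂ) : (lPoly R l).natDegree ≤ l.length := by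
  induction l with
  | nil => simp [lPoly]
  | cons x l ih =>
    have : lPoly R (x :: l) = (Polynomial.X - Polynomial.C (algebraMap ℂ R x)) * lPoly R l := by
      simp [lPoly]
    rw [this]
    refine Polynomial.natDegree_mul_le.trans ?_
    have := Polynomial.natDegree_X_sub_C_le (algebraMap ℂ R x)
    simp only [List.length_cons]
    omega

lemma lPoly_monic (l : List ℂ) : (lPoly R l).Monic := by
  induction l with
  | nil => simp [lPoly]
  | cons x l ih =>
    have : lPoly R (x :: l) = (Polynomial.X - Polynomial.C (algebraMap ℂ R x)) * lPoly R l := by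
      simp [lPoly]
    rw [this]
    exact (Polynomial.monic_X_sub_C _).mul ih

lemma natDegree_lPoly [Nontrivial R] (l : List ℂ) : (lPoly R l).natDegree = l.length := by
  induction l with
  | nil => simp [lPoly]
  | cons x l ih =>
    have : lPoly R (x :: l) = (Polynomial.X - Polynomial.C (algebraMap ℂ R x)) * lPoly R l := by
      simp [lPoly]
    rw [this, (Polynomial.monic_X_sub_C _).natDegree_mul (lPoly_monic l),
      Polynomial.natDegree_X_sub_C, ih, List.length_cons, add_comm]

lemma reflect_lPoly (l : List ℂ) : Polynomial.reflect l.length (lPoly R l) = lRev R l := by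
  induction l with
  | nil => simp [lPoly, lRev]
  | cons x l ih =>
    have h1 : lPoly R (x :: l) = (Polynomial.X - Polynomial.C (algebraMap ℂ R x)) * lPoly R l := by
      simp [lPoly]
    have h2 : lRev R (x :: l) = (1 - Polynomial.C (algebraMap ℂ R x) * Polynomial.X) * lRev R l := by
      simp [lRev]
    rw [h1, h2, List.length_cons, add_comm,
      Polynomial.reflect_mul _ _ (Polynomial.natDegree_X_sub_C_le _) (natDegree_lPoly_le l), ih,
      reflect_X_sub_C]

lemma lRev_natDegree_le (l : List ℂ) : (lRev R l).natDegree ≤ l.length := by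
  rw [← reflect_lPoly]
  exact (Polynomial.natDegree_reflect_le).trans (by simp [natDegree_lPoly_le])

lemma reflect_lRev (l : List ℂ) : Polynomial.reflect l.length (lRev R l) = lPoly R l := by
  rw [← reflect_lPoly, Polynomial.reflect_reflect]

lemma coeff_reflect_tPoly {d : ℕ} (t : Fin d → R) (J : Finset (Fin d)) (r : ℕ) :
    (Polynomial.reflect J.card (tPoly t J)).coeff r = (-1) ^ r * aeval t (elemSym d J r) := by
  have hE : aeval t (elemSym d J r) = ∑ s ∈ J.powersetCard r, ∏ j ∈ s, t j := by
    simp [elemSym]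
  rw [Polynomial.coeff_reflect]
  rcases le_or_gt r J.card with h | h
  · rw [Polynomial.revAt_le h, hE]
    have := Multiset.prod_X_sub_C_coeff (J.val.map t) (k := J.card - r) (by simp)
    rw [Finset.esymm_map_val] at this
    simp only [Multiset.map_map, Multiset.card_map, Finset.card_val, Function.comp_def] at this
    rw [Nat.sub_sub_self h] at this
    exact this
  · rw [Polynomial.revAt_eq_self_of_lt h, hE, Finset.powersetCard_eq_empty.2 h]
    simp only [Finset.sum_empty, mul_zero]
    exact Polynomial.coeff_eq_zero_of_natDegree_lt ((natDegree_tPoly_le t J).trans_lt h)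

lemma aeval_tanGen (d ℓ : ℕ) (lam : ℕ → ℕ) (a : ℕ → ℂ) (n : ℕ) (J : Finset (Fin d)) (r : ℕ)
    (t : Fin d → R) :
    PowerSeries.coeff r (hSer R (aTuple ℓ lam a n) *
      (Polynomial.reflect J.card (tPoly t J) : PowerSeries R)) =
    (-1) ^ r * aeval t (tanGen d ℓ lam a n J r) := by
  rw [PowerSeries.coeff_mul, Finset.Nat.sum_antidiagonal_eq_sum_range_succ_mk, tanGen, map_sum,
    Finset.mul_sum]
  refine Finset.sum_congr rfl fun k hk => ?_
  have hk' : k ≤ r := by simpa [Nat.lt_succ_iff] using hk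
  simp only [Polynomial.coeff_coe, coeff_reflect_tPoly, hSer, PowerSeries.coeff_mk, map_mul,
    algHom_C, map_pow, map_neg, map_one]
  obtain ⟨m, rfl⟩ := Nat.exists_eq_add_of_le hk'
  rw [Nat.add_sub_cancel_left, pow_add]
  have : ((-1 : R) ^ k) * (-1) ^ k = 1 := by rw [← mul_pow]; simp
  linear_combination (-(algebraMap ℂ R (hcomp k (aTuple ℓ lam a n))) * (-1) ^ m *
    aeval t (elemSym d J m)) * this

lemma dvd_iff_gen (d ℓ : ℕ) (lam : ℕ → ℕ) (a : ℕ → ℂ) (n : ℕ) (J : Finset (Fin d))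
    (t : Fin d → R) (hm : (aTuple ℓ lam a n).length ≤ J.card) :
    lPoly R (aTuple ℓ lam a n) ∣ tPoly t J ↔
    ∀ r, J.card - (aTuple ℓ lam a n).length < r → r ≤ J.card →
      aeval t (tanGen d ℓ lam a n J r) = 0 := by
  have key : ∀ r, aeval t (tanGen d ℓ lam a n J r) = 0 ↔
      PowerSeries.coeff r (hSer R (aTuple ℓ lam a n) *
      (Polynomial.reflect J.card (tPoly t J) : PowerSeries R)) = 0 := by
    intro r
    rw [aeval_tanGen]
    constructor
    · intro h; rw [h, mul_zero]
    · intro h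
      have h2 := congrArg (fun x => (-1 : R) ^ r * x) h
      simp only [← mul_assoc, ← mul_pow] at h2
      simpa using h2
  simp only [key]
  generalize aTuple ℓ lam a n = l at *
  set D := J.card with hD
  obtain ⟨e, he⟩ := Nat.exists_eq_add_of_le hm
  have hAH := hSer_mul_lRev (R := R) l
  constructor
  · rintro ⟨G, hG⟩ r hr _
    have hGdeg : G.natDegree ≤ e := by
      nontriviality R
      have h1 := (lPoly_monic (R := R) l).natDegree_mul' (q := G) (by
        rintro rfl
        rw [mul_zero] at hG
        exact (tPoly_monic t J).ne_zero hG)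
      have h2 := natDegree_lPoly (R := R) l
      have h3 := natDegree_tPoly_le t J
      rw [hG, h1, h2] at h3
      omega
    rw [hG, he, Polynomial.reflect_mul _ _ (natDegree_lPoly_le l) hGdeg, reflect_lPoly,
      Polynomial.coe_mul, ← mul_assoc, hAH, one_mul, Polynomial.coeff_coe]
    apply Polynomial.coeff_eq_zero_of_natDegree_lt
    refine lt_of_le_of_lt (Polynomial.natDegree_reflect_le) ?_
    rw [max_eq_left hGdeg]
    omega
  · intro h
    set E := Polynomial.reflect D (tPoly t J) with hE
    set G : Polynomial R := PowerSeries.trunc (e + 1) (hSer R l * (E : PowerSeries R)) with hGdef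
    have hEdeg : E.natDegree ≤ D :=
      Polynomial.natDegree_reflect_le.trans (by simp [hD, natDegree_tPoly_le])
    have hGdeg : G.natDegree ≤ e :=
      Nat.lt_succ_iff.1 (PowerSeries.natDegree_trunc_lt _ _)
    have hX : (PowerSeries.X : PowerSeries R) ^ (D + 1) ∣
        hSer R l * (E : PowerSeries R) - (G : PowerSeries R) := by
      rw [PowerSeries.X_pow_dvd_iff]
      intro r hr
      rw [map_sub, Polynomial.coeff_coe, hGdef, PowerSeries.coeff_trunc]
      split_ifs with h1
      · simp
      · rw [h r (by omega) (by omega), sub_zero]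
    have hX2 : (PowerSeries.X : PowerSeries R) ^ (D + 1) ∣
        ((E - lRev R l * G : Polynomial R) : PowerSeries R) := by
      have : ((E - lRev R l * G : Polynomial R) : PowerSeries R) =
        (hSer R l * (E : PowerSeries R) - (G : PowerSeries R)) * (lRev R l : PowerSeries R) := by
        rw [Polynomial.coe_sub, Polynomial.coe_mul]
        linear_combination (-(E : PowerSeries R)) * hAH
      rw [this]
      exact Dvd.dvd.mul_right hX _
    have hEG : E = lRev R l * G := by
      rw [← sub_eq_zero]
      ext r
      rw [Polynomial.coeff_zero]
      rcases le_or_gt r D with hr | hr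
      · rw [PowerSeries.X_pow_dvd_iff] at hX2
        have := hX2 r (by omega)
        rwa [Polynomial.coeff_coe] at this
      · apply Polynomial.coeff_eq_zero_of_natDegree_lt
        refine lt_of_le_of_lt ((Polynomial.natDegree_sub_le _ _).trans (max_le hEdeg ?_)) hr
        refine Polynomial.natDegree_mul_le.trans ?_
        have := lRev_natDegree_le (R := R) l
        omega
    have : tPoly t J = Polynomial.reflect D E := by rw [hE, Polynomial.reflect_reflect]
    rw [this, hEG, he, Polynomial.reflect_mul _ _ (lRev_natDegree_le l) hGdeg, reflect_lRev]
    exact dvd_mul_right _ _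

end Criterion

/-! ### Part 2: the upper bound -/

section Upper

/-- `∏_j (z - a_j)^{max(c_j - n, 0)}`. -/
def cPoly (R : Type) [CommRing R] {ι : Type} [Fintype ι] (b : ι → R) (c : ι → ℕ) (n : ℕ) :
    Polynomial R :=
  ∏ j, (Polynomial.X - Polynomial.C (b j)) ^ (c j - n)

section cPolyLemmas

variable {R : Type} [CommRing R] {ι : Type} [Fintype ι] 

lemma cPoly_monic (b : ι → R) (c : ι → ℕ) (n : ℕ) : (cPoly R b c n).Monic :=
  Polynomial.monic_prod_of_monic _ _ fun _ _ => (Polynomial.monic_X_sub_C _).pow _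

lemma natDegree_cPoly_zero [Nontrivial R] (b : ι → R) (c : ι → ℕ) :
    (cPoly R b c 0).natDegree = ∑ j, c j := by
  rw [cPoly, Polynomial.natDegree_prod_of_monic]
  · refine Finset.sum_congr rfl fun j _ => ?_
    rw [(Polynomial.monic_X_sub_C _).natDegree_pow]
    simp
  · exact fun _ _ => (Polynomial.monic_X_sub_C _).pow _

lemma cPoly_succ (b : ι → R) (c : ι → ℕ) (n : ℕ) :
    cPoly R b c n = cPoly R b c (n + 1) * tPoly b (Finset.univ.filter fun j => n < c j) := by
  rw [cPoly, cPoly, tPoly, Finset.prod_filter, ← Finset.prod_mul_distrib]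
  refine Finset.prod_congr rfl fun j _ => ?_
  split_ifs with h
  · rw [← pow_succ]; congr 1; omega
  · rw [mul_one]; congr 1; omega

lemma cPoly_update [DecidableEq ι] (b : ι → R) (c : ι → ℕ) (n : ℕ) (j : ι) :
    cPoly R b (Function.update c j (c j - 1)) n =
      cPoly R b c (n + 1) * tPoly b ((Finset.univ.filter fun i => n < c i).erase j) := by
  have : (Finset.univ.filter fun i => n < c i).erase j =
      Finset.univ.filter fun i => n < c i ∧ i ≠ j := by
    ext i; simp [and_comm]
  rw [this, cPoly, cPoly, tPoly, Finset.prod_filter, ← Finset.prod_mul_distrib]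
  refine Finset.prod_congr rfl fun i _ => ?_
  by_cases hij : i = j
  · subst hij
    simp only [Function.update_self, ne_eq, not_true_eq_false, and_false, if_false, mul_one]
    congr 1; omega
  · rw [Function.update_of_ne hij]
    split_ifs with h
    · rw [← pow_succ]; congr 1; omega
    · rw [mul_one]; congr 1
      have : ¬ n < c i := fun h' => h ⟨h', hij⟩
      omega

lemma map_cPoly {S : Type} [CommRing S] (q : R →+* S) (b : ι → R) (c : ι → ℕ) (n : ℕ) :
    (cPoly R b c n).map q = cPoly S (fun j => q (b j)) c n := by
  simp [cPoly, Polynomial.map_prod]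

lemma map_tPoly {S σ : Type} [CommRing S] (q : R →+* S) (t : σ → R) (J : Finset σ) :
    (tPoly t J).map q = tPoly (fun j => q (t j)) J := by
  simp [tPoly, Polynomial.map_prod]

lemma eval_tPoly {σ : Type} (t : σ → R) (J : Finset σ) (x : R) :
    (tPoly t J).eval x = ∏ j ∈ J, (x - t j) := by
  simp [tPoly, Polynomial.eval_prod]

end cPolyLemmas

lemma multinomial_rec {ι : Type} [Fintype ι] [DecidableEq ι] (c : ι → ℕ) (d : ℕ)
    (hc : ∑ j, c j = d + 1) :
    ∑ j ∈ Finset.univ.filter (fun j => 0 < c j),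
      Nat.multinomial Finset.univ (Function.update c j (c j - 1)) =
    Nat.multinomial Finset.univ c := by
  have hpos : 0 < ∏ i, (c i).factorial := Finset.prod_pos fun i _ => Nat.factorial_pos _
  apply Nat.eq_of_mul_eq_mul_left hpos
  rw [Nat.multinomial_spec, hc, Finset.mul_sum]
  have : ∀ j ∈ Finset.univ.filter (fun j => 0 < c j),
      (∏ i, (c i).factorial) * Nat.multinomial Finset.univ (Function.update c j (c j - 1)) =
      c j * d.factorial := by
    intro j hj
    have hj : 0 < c j := by simpa using hj
    have hs : ∑ i, Function.update c j (c j - 1) i = d := by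
      rw [Finset.sum_update_of_mem (Finset.mem_univ j)]
      rw [← Finset.add_sum_erase _ _ (Finset.mem_univ j)] at hc
      rw [← Finset.erase_eq]
      omega
    have h1 := Nat.multinomial_spec Finset.univ (Function.update c j (c j - 1))
    rw [hs] at h1
    rw [← h1, ← mul_assoc]
    congr 1
    rw [← Finset.mul_prod_erase _ _ (Finset.mem_univ j),
      ← Finset.mul_prod_erase _ (fun i => (Function.update c j (c j - 1) i).factorial)
        (Finset.mem_univ j), ← mul_assoc]
    congr 1
    · rw [Function.update_self, Nat.mul_factorial_pred (by omega)]
    · refine Finset.prod_congr rfl fun i hi => ?_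
      rw [Function.update_of_ne (Finset.ne_of_mem_erase hi)]
  rw [Finset.sum_congr rfl this, ← Finset.sum_mul, Nat.factorial_succ]
  congr 1
  rw [← hc, Finset.sum_filter]
  refine Finset.sum_congr rfl fun j _ => ?_
  split_ifs <;> omega

lemma rank_quot_one {R : Type} [CommRing R] [Algebra ℂ R] :
    Module.rank ℂ (R ⧸ Ideal.span {(1 : R)}) = 0 := by
  have : Subsingleton (R ⧸ (Ideal.span {(1 : R)})) :=
    Ideal.Quotient.subsingleton_iff.2 Ideal.span_singleton_one
  have h : (Module.rank ℂ (R ⧸ Ideal.span {(1 : R)})) < 1 := by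
    refine lt_of_le_of_lt (LinearMap.rank_le_of_surjective (0 : (Fin 0 → ℂ) →ₗ[ℂ] _)
      fun x => ⟨0, Subsingleton.elim _ _⟩) ?_
    simp
  rwa [Cardinal.lt_one_iff] at h

/-- The ideal `(f g : f)`. -/
def colonIdeal {R : Type} [CommRing R] (f g : R) : Ideal R :=
  LinearMap.ker ((Ideal.span {f * g}).mkQ ∘ₗ LinearMap.mulLeft R f)

lemma mem_colonIdeal {R : Type} [CommRing R] (f g x : R) :
    x ∈ colonIdeal f g ↔ f * x ∈ Ideal.span {f * g} := by
  rw [colonIdeal, LinearMap.mem_ker, LinearMap.comp_apply, Submodule.mkQ_apply,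
    Submodule.Quotient.mk_eq_zero, LinearMap.mulLeft_apply]

lemma rank_quot_mul_le {R : Type} [CommRing R] [Algebra ℂ R] (f g : R) :
    Module.rank ℂ (R ⧸ Ideal.span {f * g}) ≤
      Module.rank ℂ (R ⧸ Ideal.span {f}) + Module.rank ℂ (R ⧸ colonIdeal f g) := by
  let ψ : (R ⧸ colonIdeal f g) →ₗ[R] (R ⧸ Ideal.span {f * g}) :=
    (colonIdeal f g).liftQ ((Ideal.span {f * g}).mkQ ∘ₗ LinearMap.mulLeft R f) le_rfl
  let N := LinearMap.range ψ
  have hle : Ideal.span {f} ≤ LinearMap.ker (N.mkQ ∘ₗ (Ideal.span {f * g}).mkQ) := by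
    rw [Ideal.span_singleton_le_iff_mem]
    rw [LinearMap.mem_ker, LinearMap.comp_apply, Submodule.mkQ_apply, Submodule.Quotient.mk_eq_zero]
    refine ⟨Submodule.Quotient.mk 1, ?_⟩
    show (Ideal.span {f * g}).mkQ (f * 1) = _
    rw [mul_one]
  let χ : (R ⧸ Ideal.span {f}) →ₗ[R] ((R ⧸ Ideal.span {f * g}) ⧸ N) :=
    (Ideal.span {f}).liftQ (N.mkQ ∘ₗ (Ideal.span {f * g}).mkQ) hle
  have hχ : Function.Surjective χ := by
    rw [← LinearMap.range_eq_top, Submodule.range_liftQ, LinearMap.range_eq_top]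
    exact (Submodule.mkQ_surjective _).comp (Submodule.mkQ_surjective _)
  rw [← LinearMap.rank_range_add_rank_ker (N.mkQ.restrictScalars ℂ)]
  refine add_le_add ?_ ?_
  · refine (Submodule.rank_le _).trans ?_
    exact LinearMap.rank_le_of_surjective (χ.restrictScalars ℂ) hχ
  · have : LinearMap.ker (N.mkQ.restrictScalars ℂ) = LinearMap.range (ψ.restrictScalars ℂ) := by
      ext x
      simp [N]
    rw [this]
    exact rank_range_le _

variable {ι : Type} [Fintype ι] [DecidableEq ι]

/-- Upper bound, for arbitrary algebras generated by `t_0, …, t_{d-1}`. -/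
def UpperProp (a : ι → ℂ) (d : ℕ) : Prop :=
  ∀ (c : ι → ℕ), ∑ j, c j = d → ∀ (R : Type) [CommRing R] [Algebra ℂ R] (t : ℕ → R),
    Algebra.adjoin ℂ (t '' {i | i < d}) = ⊤ →
    (∀ n, ∀ J ⊆ Finset.range d, J.card + n = d →
      cPoly R (fun j => algebraMap ℂ R (a j)) c n ∣ tPoly t J) →
    Module.rank ℂ R ≤ (Nat.multinomial Finset.univ c : Cardinal)

lemma upper_step (a : ι → ℂ) (d : ℕ) (ih : UpperProp a d) (c : ι → ℕ) (hc : ∑ j, c j = d + 1)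
    (R : Type) [CommRing R] [Algebra ℂ R] (t : ℕ → R)
    (hgen : Algebra.adjoin ℂ (t '' {i | i < d + 1}) = ⊤)
    (hdvd : ∀ n, ∀ J ⊆ Finset.range (d + 1), J.card + n = d + 1 →
      cPoly R (fun j => algebraMap ℂ R (a j)) c n ∣ tPoly t J)
    (j : ι) (hj : 0 < c j) (T : Finset ι) (hT : ∀ i, c j < c i → i ∈ T) :
    Module.rank ℂ (R ⧸ colonIdeal (∏ i ∈ T, (t d - algebraMap ℂ R (a i)))
        (t d - algebraMap ℂ R (a j))) ≤
      (Nat.multinomial Finset.univ (Function.update c j (c j - 1)) : Cardinal) := by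
  set f := ∏ i ∈ T, (t d - algebraMap ℂ R (a i)) with hf
  set K := colonIdeal f (t d - algebraMap ℂ R (a j)) with hK
  let q : R →ₐ[ℂ] R ⧸ K := Ideal.Quotient.mkₐ ℂ K
  have hq : Function.Surjective q := Ideal.Quotient.mkₐ_surjective ℂ K
  have hq0 : ∀ x, x ∈ K → q x = 0 := fun x hx => Ideal.Quotient.eq_zero_iff_mem.2 hx
  have htd : q (t d) = algebraMap ℂ _ (a j) := by
    have : q (t d - algebraMap ℂ R (a j)) = 0 := by
      apply hq0
      rw [hK, mem_colonIdeal]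
      exact Ideal.mem_span_singleton_self _
    rw [map_sub, sub_eq_zero] at this
    rw [this, AlgHom.commutes]
  refine ih _ ?_ (R ⧸ K) (fun i => q (t i)) ?_ ?_
  · rw [Finset.sum_update_of_mem (Finset.mem_univ j)]
    rw [← Finset.add_sum_erase _ _ (Finset.mem_univ j)] at hc
    rw [← Finset.erase_eq]
    omega
  · have h1 : Algebra.adjoin ℂ (q '' (t '' {i | i < d + 1})) = ⊤ := by
      rw [← AlgHom.map_adjoin, hgen, Algebra.map_top, AlgHom.range_eq_top]
      exact hq
    rw [← top_le_iff, ← h1]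
    apply Algebra.adjoin_le
    rintro _ ⟨_, ⟨i, hi, rfl⟩, rfl⟩
    rcases Nat.lt_succ_iff_lt_or_eq.1 hi with h | h
    · exact Algebra.subset_adjoin ⟨i, h, rfl⟩
    · subst h
      rw [htd]
      exact Subalgebra.algebraMap_mem _ _
  · intro n J hJ hn
    have hdJ : d ∉ J := fun h => by simpa using hJ h
    obtain ⟨H, hH⟩ := hdvd n (insert d J) (by
      intro i hi
      rw [Finset.mem_insert] at hi
      rcases hi with rfl | hi
      · simp
      · have := hJ hi
        simp only [Finset.mem_range] at *
        omega) (by rw [Finset.card_insert_of_notMem hdJ]; omega)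
    obtain ⟨G, hG⟩ := hdvd (n + 1) J (by
      intro i hi
      have := hJ hi
      simp only [Finset.mem_range] at *
      omega) (by omega)
    have hins : tPoly t (insert d J) = (Polynomial.X - Polynomial.C (t d)) * tPoly t J := by
      rw [tPoly, Finset.prod_insert hdJ, tPoly]
    rw [hins, hG, cPoly_succ _ _ n] at hH
    set b : ι → R := fun j => algebraMap ℂ R (a j) with hb
    set S := Finset.univ.filter fun i => n < c i with hS
    have hGH : (Polynomial.X - Polynomial.C (t d)) * G = tPoly b S * H := by
      apply (cPoly_monic b c (n + 1)).isRegular.left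
      show cPoly R b c (n + 1) * _ = cPoly R b c (n + 1) * _
      linear_combination hH
    have hbq : (fun j => algebraMap ℂ (R ⧸ K) (a j)) = fun j => (q : R →+* R ⧸ K) (b j) := by
      funext i
      exact (q.commutes (a i)).symm
    have hGm := congrArg (Polynomial.map (q : R →+* R ⧸ K)) hG
    have hGHm := congrArg (Polynomial.map (q : R →+* R ⧸ K)) hGH
    simp only [Polynomial.map_mul, Polynomial.map_sub, Polynomial.map_X, Polynomial.map_C,
      map_tPoly, map_cPoly] at hGm hGHm
    rw [cPoly_update, hbq]
    have goal : tPoly (fun j => (q : R →+* R ⧸ K) (b j)) (S.erase j) ∣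
        G.map (q : R →+* R ⧸ K) := by
      by_cases hjn : n < c j
      · have hjS : j ∈ S := by simp [hS, hjn]
        have hjb : (q : R →+* R ⧸ K) (b j) = (q : R →+* R ⧸ K) (t d) := by
          show q (b j) = q (t d)
          rw [htd]; exact q.commutes _
        refine ⟨H.map (q : R →+* R ⧸ K), ?_⟩
        apply (Polynomial.monic_X_sub_C ((q : R →+* R ⧸ K) (t d))).isRegular.left
        show (Polynomial.X - Polynomial.C ((q : R →+* R ⧸ K) (t d))) * _ =
          (Polynomial.X - Polynomial.C ((q : R →+* R ⧸ K) (t d))) * _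
        rw [hGHm, ← mul_assoc]
        congr 1
        rw [tPoly, tPoly, ← Finset.mul_prod_erase _ _ hjS, hjb]
      · have hjS : j ∉ S := by simp [hS]; omega
        rw [Finset.erase_eq_of_notMem hjS]
        have hST : S ⊆ T := by
          intro i hi
          apply hT
          have : n < c i := by simpa [hS] using hi
          omega
        have hev := congrArg (Polynomial.eval (t d)) hGH
        rw [Polynomial.eval_mul, Polynomial.eval_mul, eval_tPoly] at hev
        simp only [Polynomial.eval_sub, Polynomial.eval_X, Polynomial.eval_C, sub_self,
          zero_mul] at hev
        have hfH : f * H.eval (t d) = 0 := by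
          rw [hf, ← Finset.prod_sdiff hST, mul_assoc, ← hev, mul_zero]
        have hroot : (H.map (q : R →+* R ⧸ K)).IsRoot ((q : R →+* R ⧸ K) (t d)) := by
          rw [Polynomial.IsRoot, Polynomial.eval_map_apply]
          apply hq0
          rw [hK, mem_colonIdeal, hfH]
          exact zero_mem _
        obtain ⟨H3, hH3⟩ := Polynomial.dvd_iff_isRoot.2 hroot
        refine ⟨H3, ?_⟩
        apply (Polynomial.monic_X_sub_C ((q : R →+* R ⧸ K) (t d))).isRegular.left
        show (Polynomial.X - Polynomial.C ((q : R →+* R ⧸ K) (t d))) * _ =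
          (Polynomial.X - Polynomial.C ((q : R →+* R ⧸ K) (t d))) * _
        rw [hGHm, hH3]
        ring
    show _ ∣ tPoly (fun i => (q : R →+* R ⧸ K) (t i)) J
    rw [hGm]
    exact mul_dvd_mul_left _ goal

lemma upper_bound (a : ι → ℂ) (d : ℕ) : UpperProp a d := by
  induction d with
  | zero =>
    intro c hc R _ _ t hgen _
    have hs : Function.Surjective (Algebra.linearMap ℂ R) := by
      intro x
      have hx : x ∈ Algebra.adjoin ℂ (t '' {i | i < 0}) := by rw [hgen]; trivial
      simp only [Nat.not_lt_zero, Set.ofPred_false, Set.image_empty, Algebra.adjoin_empty] at hx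
      exact hx
    refine (LinearMap.rank_le_of_surjective _ hs).trans ?_
    rw [Module.rank_self]
    exact_mod_cast Nat.multinomial_pos Finset.univ c
  | succ d ih =>
    intro c hc R _ _ t hgen hdvd
    have claim : ∀ m (T : Finset ι), T.card = m → (∀ j ∈ T, 0 < c j) →
        (∀ j ∈ T, ∀ i, i ∉ T → c i ≤ c j) →
        Module.rank ℂ (R ⧸ Ideal.span {∏ i ∈ T, (t d - algebraMap ℂ R (a i))}) ≤
        ((∑ j ∈ T, Nat.multinomial Finset.univ (Function.update c j (c j - 1)) : ℕ) :
          Cardinal) := by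
      intro m
      induction m with
      | zero =>
        intro T hT _ _
        rw [Finset.card_eq_zero] at hT
        subst hT
        simp only [Finset.prod_empty, Finset.sum_empty, Nat.cast_zero]
        exact rank_quot_one.le
      | succ m ihm =>
        intro T hT hpos hup
        obtain ⟨j, hjT, hmin⟩ := Finset.exists_min_image T c (Finset.card_pos.1 (by omega))
        rw [← Finset.mul_prod_erase _ _ hjT, ← Finset.add_sum_erase _ _ hjT, mul_comm,
          Nat.cast_add, add_comm]
        refine (rank_quot_mul_le _ _).trans (add_le_add ?_ ?_)
        · apply ihm
          · rw [Finset.card_erase_of_mem hjT]; omega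
          · exact fun i hi => hpos i (Finset.mem_of_mem_erase hi)
          · intro i hi k hk
            have hiT := Finset.mem_of_mem_erase hi
            by_cases hkT : k ∈ T
            · have : k = j := by
                by_contra h
                exact hk (Finset.mem_erase.2 ⟨h, hkT⟩)
              subst this
              exact hmin i hiT
            · exact hup i hiT k hkT
        · apply upper_step a d ih c hc R t hgen hdvd j (hpos j hjT)
          intro i hi
          rw [Finset.mem_erase]
          constructor
          · rintro rfl; omega
          · by_contra h
            have := hup j hjT i h
            omega
    have hfin := claim _ (Finset.univ.filter fun j => 0 < c j) rfl (by simp) (by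
      intro j hj i hi
      simp only [Finset.mem_filter, Finset.mem_univ, true_and] at hi hj
      omega)
    rw [multinomial_rec c d hc] at hfin
    have hzero : ∏ i ∈ Finset.univ.filter (fun j => 0 < c j),
        (t d - algebraMap ℂ R (a i)) = 0 := by
      rcases subsingleton_or_nontrivial R with _ | _
      · exact Subsingleton.elim _ _
      set b : ι → R := fun j => algebraMap ℂ R (a j) with hb
      have h0 := hdvd 0 (Finset.range (d + 1)) le_rfl (by simp)
      have h0' := Polynomial.eq_of_monic_of_dvd_of_natDegree_le (cPoly_monic b c 0)
        (tPoly_monic t _) h0 (by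
          rw [natDegree_cPoly_zero, hc]
          exact (natDegree_tPoly_le _ _).trans (by simp))
      obtain ⟨G, hG⟩ := hdvd 1 (Finset.range d) (by simp) (by simp)
      have hins : tPoly t (Finset.range (d + 1)) =
          tPoly t (Finset.range d) * (Polynomial.X - Polynomial.C (t d)) := by
        rw [tPoly, Finset.prod_range_succ, tPoly]
      rw [hins, hG, cPoly_succ _ _ 0] at h0'
      have hGH : (Polynomial.X - Polynomial.C (t d)) * G =
          tPoly b (Finset.univ.filter fun j => 0 < c j) := by
        apply (cPoly_monic b c 1).isRegular.left
        show cPoly R b c 1 * _ = cPoly R b c 1 * _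
        rw [← zero_add 1]
        linear_combination h0'
      have := congrArg (Polynomial.eval (t d)) hGH
      rw [eval_tPoly] at this
      simpa using this.symm
    rw [hzero] at hfin
    refine le_trans ?_ hfin
    refine LinearMap.rank_le_of_injective
      ((Ideal.span {(0 : R)}).mkQ.restrictScalars ℂ) ?_
    show Function.Injective (Ideal.span {(0 : R)}).mkQ
    rw [← LinearMap.ker_eq_bot, Submodule.ker_mkQ]
    simp

end Upper

/-! ### Part 3: the lower bound -/

section Lower

variable {ι : Type} [Fintype ι] [DecidableEq ι]

/-- The points: rearrangements with prescribed fibre sizes. -/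
abbrev Pts (d : ℕ) (c : ι → ℕ) : Type :=
  {x : Fin d → ι // ∀ j, (Finset.univ.filter fun i => x i = j).card = c j}

lemma exists_pt (d : ℕ) (c : ι → ℕ) (hc : ∑ j, c j = d) : Nonempty (Pts d c) := by
  have hcard : Fintype.card (Fin d) = Fintype.card (Σ j, Fin (c j)) := by
    simp [hc]
  let e := Fintype.equivOfCardEq hcard
  refine ⟨fun i => (e i).1, fun j => ?_⟩
  have h1 : Finset.card (Finset.univ : Finset (Fin (c j))) =
      (Finset.univ.filter fun i => (e i).1 = j).card := by
    refine Finset.card_bij (fun k _ => e.symm ⟨j, k⟩) ?_ ?_ ?_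
    · intro k _
      simp
    · intro k _ l _ h
      simpa using h
    · intro i hi
      have hi : (e i).1 = j := by simpa using hi
      subst hi
      exact ⟨(e i).2, Finset.mem_univ _, by simp⟩
  rw [← h1]
  simp

lemma card_pts (d : ℕ) (c : ι → ℕ) (hc : ∑ j, c j = d) :
    Nat.multinomial Finset.univ c ≤ Fintype.card (Pts d c) := by
  obtain ⟨x0⟩ := exists_pt d c hc
  have hpos : 0 < ∏ i, (c i).factorial := Finset.prod_pos fun i _ => Nat.factorial_pos _
  apply Nat.le_of_mul_le_mul_left _ hpos
  rw [Nat.multinomial_spec, hc]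
  let F : Equiv.Perm (Fin d) → Pts d c := fun σ => ⟨x0.1 ∘ σ, fun j => by
    rw [← x0.2 j]
    refine Finset.card_bij (fun i _ => σ i) ?_ ?_ ?_
    · intro i hi; simpa using hi
    · intro i _ k _ h; exact σ.injective h
    · intro i hi
      exact ⟨σ.symm i, by simpa using hi, by simp⟩⟩
  have h1 := Finset.card_le_mul_card_image (f := F) (Finset.univ) (∏ i, (c i).factorial) (by
    intro y hy
    obtain ⟨σ0, _, hσ0⟩ := Finset.mem_image.1 hy
    have h2 : ∏ i, (c i).factorial = Fintype.card {g : Equiv.Perm (Fin d) // x0.1 ∘ g = x0.1} := by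
      rw [DomMulAct.stabilizer_card]
      refine Finset.prod_congr rfl fun j _ => ?_
      rw [← x0.2 j, Fintype.card_subtype]
    rw [h2, Fintype.card_subtype]
    refine Finset.card_le_card_of_injOn (fun σ => σ * σ0⁻¹) ?_ ?_
    · intro σ hσ
      have hσ : F σ = y := by simpa using hσ
      rw [← hσ0] at hσ
      have h3 : x0.1 ∘ σ = x0.1 ∘ σ0 := congrArg Subtype.val hσ
      simp only [Finset.coe_filter, Finset.mem_univ, true_and, Set.mem_ofPred_eq]
      funext i
      have := congrFun h3 (σ0⁻¹ i)
      simpa using this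
    · intro σ _ τ _ h
      exact mul_right_cancel h)
  rw [Finset.card_univ, Fintype.card_perm, Fintype.card_fin] at h1
  refine h1.trans (Nat.mul_le_mul_left _ ?_)
  exact Finset.card_le_univ _

lemma cPoly_dvd_pt {S : Type} [CommRing S] (b : ι → S) (d : ℕ) (c : ι → ℕ) (x : Pts d c)
    (n : ℕ) (J : Finset (Fin d)) (hn : J.card + n = d) :
    cPoly S b c n ∣ tPoly (fun i => b (x.1 i)) J := by
  rw [tPoly, ← Finset.prod_fiberwise' J x.1 (fun j => Polynomial.X - Polynomial.C (b j)), cPoly]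
  refine Finset.prod_dvd_prod_of_dvd _ _ fun j _ => ?_
  rw [Finset.prod_const]
  apply pow_dvd_pow
  rw [← x.2 j, Nat.sub_le_iff_le_add]
  have h1 : (Finset.univ.filter fun i => x.1 i = j) ⊆ (J.filter fun i => x.1 i = j) ∪ Jᶜ := by
    intro i hi
    by_cases h : i ∈ J
    · simp only [Finset.mem_union, Finset.mem_filter]; left; exact ⟨h, by simpa using hi⟩
    · simp [h]
  refine (Finset.card_le_card h1).trans ((Finset.card_union_le _ _).trans ?_)
  rw [Finset.card_compl, Fintype.card_fin]
  omega

/-- The quotient at `s = 0`. -/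
abbrev Fib (M : Type) [CommRing M] [Algebra (Polynomial ℂ) M] : Type :=
  M ⧸ Ideal.span {algebraMap (Polynomial ℂ) M Polynomial.X}

section Abstract

variable {M : Type} [CommRing M] [Algebra (Polynomial ℂ) M] [Algebra ℂ M] [IsScalarTower ℂ (Polynomial ℂ) M]

lemma fib_algebraMap (s : (Polynomial ℂ)) :
    Ideal.Quotient.mk (Ideal.span {algebraMap (Polynomial ℂ) M Polynomial.X}) (algebraMap (Polynomial ℂ) M s) =
      algebraMap ℂ (Fib M) (s.eval 0) := by
  have h1 : algebraMap ℂ (Fib M) (s.eval 0) =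
      Ideal.Quotient.mk (Ideal.span {algebraMap (Polynomial ℂ) M Polynomial.X})
        (algebraMap (Polynomial ℂ) M (Polynomial.C (s.eval 0))) := by
    rw [← Polynomial.algebraMap_eq, ← IsScalarTower.algebraMap_apply ℂ (Polynomial ℂ) M]
    rfl
  rw [h1, Ideal.Quotient.eq, ← map_sub, Ideal.mem_span_singleton]
  apply map_dvd
  rw [Polynomial.X_dvd_iff]
  simp [Polynomial.coeff_zero_eq_eval_zero]

/-- Semicontinuity: the fibre dimension is at least the generic rank. -/
lemma card_le_finrank_fib {P : Type} [Fintype P] [Module.Finite (Polynomial ℂ) M]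
    [Module.Finite ℂ (Fib M)]
    (f : P → M) (hf : LinearIndependent (Polynomial ℂ) f) :
    Fintype.card P ≤ Module.finrank ℂ (Fib M) := by
  classical
  let B := Module.finBasis ℂ (Fib M)
  have hsurj : Function.Surjective
      (Ideal.Quotient.mk (Ideal.span {algebraMap (Polynomial ℂ) M Polynomial.X})) :=
    Ideal.Quotient.mk_surjective
  choose v hv using fun k => hsurj (B k)
  let N : Submodule (Polynomial ℂ) M := Submodule.span (Polynomial ℂ) (Set.range v)
  have hle : (⊤ : Submodule (Polynomial ℂ) M) ≤
      N ⊔ (Ideal.span {(Polynomial.X : (Polynomial ℂ))}) • (⊤ : Submodule (Polynomial ℂ) M) := by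
    intro m _
    have hm : m = (∑ k, (Polynomial.C (B.repr (Ideal.Quotient.mk _ m) k)) • v k) +
      (m - ∑ k, (Polynomial.C (B.repr (Ideal.Quotient.mk _ m) k)) • v k) := by ring
    rw [hm]
    apply Submodule.add_mem_sup
    · exact Submodule.sum_mem _ fun k _ =>
        Submodule.smul_mem _ _ (Submodule.subset_span ⟨k, rfl⟩)
    · have h0 : m - ∑ k, (Polynomial.C (B.repr (Ideal.Quotient.mk _ m) k)) • v k ∈
          Ideal.span {algebraMap (Polynomial ℂ) M Polynomial.X} := by
        rw [← Ideal.Quotient.eq, map_sum]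
        conv_lhs => rw [← B.sum_repr (Ideal.Quotient.mk _ m)]
        refine Finset.sum_congr rfl fun k _ => ?_
        rw [Algebra.smul_def, Algebra.smul_def, map_mul, fib_algebraMap, hv]
        simp
      rw [Ideal.mem_span_singleton] at h0
      obtain ⟨y, hy⟩ := h0
      rw [hy, ← Algebra.smul_def]
      exact Submodule.smul_mem_smul (Ideal.mem_span_singleton_self _) trivial
  obtain ⟨r, hr1, hr⟩ := Submodule.exists_sub_one_mem_and_smul_le_of_fg_of_le_sup
    (Module.Finite.fg_top) le_rfl hle
  have hr0 : r ≠ 0 := by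
    rintro rfl
    rw [Ideal.mem_span_singleton, Polynomial.X_dvd_iff] at hr1
    simp at hr1
  have hli : LinearIndependent (Polynomial ℂ) fun x => r • f x := by
    rw [Fintype.linearIndependent_iff] at hf ⊢
    intro g hg i
    have := hf (fun i => g i * r) (by simpa [mul_smul] using hg) i
    exact (mul_eq_zero.1 this).resolve_right hr0
  have h1 := linearIndependent_le_span_aux' _ hli (Set.range v) (by
    rintro _ ⟨x, rfl⟩
    exact hr (Submodule.smul_mem_pointwise_smul _ _ _ trivial))
  refine h1.trans ?_
  refine (Fintype.card_range_le v).trans ?_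
  simp

lemma lower_abs [Module.Finite (Polynomial ℂ) M] (a e : ι → ℂ) (d : ℕ) (c : ι → ℕ) (hc : ∑ j, c j = d)
    (b : ι → (Polynomial ℂ)) (hb : Function.Injective b)
    (hbdef : b = fun j => Polynomial.C (a j) + Polynomial.C (e j) * Polynomial.X)
    (T : Fin d → M) (hT : Algebra.adjoin (Polynomial ℂ) (Set.range T) = ⊤)
    (ev : Pts d c → (M →ₐ[(Polynomial ℂ)] (Polynomial ℂ))) (hev : ∀ m : M, (∀ x, ev x m = 0) → m = 0)
    (hevT : ∀ x i, ev x (T i) = b (x.1 i)) :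
    ∃ (Q : Type) (_ : CommRing Q) (_ : Algebra ℂ Q) (t : Fin d → Q),
      Algebra.adjoin ℂ (Set.range t) = ⊤ ∧
      (∀ n, ∀ J : Finset (Fin d), J.card + n = d →
        cPoly Q (fun j => algebraMap ℂ Q (a j)) c n ∣ tPoly t J) ∧
      (Module.Finite ℂ Q → Nat.multinomial Finset.univ c ≤ Module.finrank ℂ Q) := by
  let mk : M →+* Fib M := Ideal.Quotient.mk (Ideal.span {algebraMap (Polynomial ℂ) M Polynomial.X})
  refine ⟨Fib M, inferInstance, inferInstance, fun i => mk (T i), ?_, ?_, ?_⟩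
  · rw [eq_top_iff]
    intro q _
    obtain ⟨m, rfl⟩ := Ideal.Quotient.mk_surjective q
    have hm : m ∈ Algebra.adjoin (Polynomial ℂ) (Set.range T) := by rw [hT]; trivial
    induction hm using Algebra.adjoin_induction with
    | mem x hx =>
      obtain ⟨i, rfl⟩ := hx
      exact Algebra.subset_adjoin ⟨i, rfl⟩
    | algebraMap s =>
      rw [fib_algebraMap]
      exact Subalgebra.algebraMap_mem _ _
    | add x y _ _ hx hy =>
      rw [map_add]
      exact add_mem (hx trivial) (hy trivial)
    | mul x y _ _ hx hy =>
      rw [map_mul]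
      exact mul_mem (hx trivial) (hy trivial)
  · intro n J hn
    have hM : cPoly M (fun j => algebraMap (Polynomial ℂ) M (b j)) c n ∣ tPoly T J := by
      rw [← Polynomial.modByMonic_eq_zero_iff_dvd (cPoly_monic _ _ _)]
      ext k
      rw [Polynomial.coeff_zero]
      apply hev
      intro x
      have h1 : Polynomial.map (ev x : M →+* (Polynomial ℂ))
          (tPoly T J %ₘ cPoly M (fun j => algebraMap (Polynomial ℂ) M (b j)) c n) = 0 := by
        rw [Polynomial.map_modByMonic _ (cPoly_monic _ _ _),
          Polynomial.modByMonic_eq_zero_iff_dvd ((cPoly_monic _ _ _).map _), map_cPoly, map_tPoly]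
        have h2 : (fun j => (ev x : M →+* (Polynomial ℂ)) (algebraMap (Polynomial ℂ) M (b j))) = b := by
          funext j
          exact (ev x).commutes (b j)
        have h3 : (fun i => (ev x : M →+* (Polynomial ℂ)) (T i)) = fun i => b (x.1 i) := by
          funext i
          exact hevT x i
        rw [h2, h3]
        exact cPoly_dvd_pt b d c x n J hn
      have h4 := congrArg (fun p => Polynomial.coeff p k) h1
      simpa [Polynomial.coeff_map] using h4
    have hm := Polynomial.map_dvd mk hM
    rw [map_cPoly, map_tPoly] at hm
    have h5 : (fun j => mk (algebraMap (Polynomial ℂ) M (b j))) = fun j => algebraMap ℂ (Fib M) (a j) := by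
      funext j
      refine (fib_algebraMap (M := M) (b j)).trans ?_
      rw [hbdef]
      simp
    rwa [h5] at hm
  · intro hfin
    refine (card_pts d c hc).trans ?_
    have hsep : ∀ x y : Pts d c, ∃ u : M, x ≠ y → ev x u ≠ 0 ∧ ev y u = 0 := by
      intro x y
      by_cases hxy : x = y
      · exact ⟨0, fun h => absurd hxy h⟩
      · have : ∃ i, x.1 i ≠ y.1 i := by
          by_contra! h
          exact hxy (Subtype.ext (funext h))
        obtain ⟨i, hi⟩ := this
        refine ⟨T i - algebraMap (Polynomial ℂ) M (b (y.1 i)), fun _ => ⟨?_, ?_⟩⟩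
        · rw [map_sub, hevT, AlgHom.commutes]
          exact sub_ne_zero.2 fun h => hi (hb h)
        · rw [map_sub, hevT, AlgHom.commutes]
          exact sub_self _
    choose u hu using hsep
    let f : Pts d c → M := fun x => ∏ y ∈ Finset.univ.erase x, u x y
    have hf0 : ∀ x y, x ≠ y → ev y (f x) = 0 := by
      intro x y hxy
      rw [map_prod]
      exact Finset.prod_eq_zero (Finset.mem_erase.2 ⟨hxy.symm, Finset.mem_univ y⟩) (hu x y hxy).2
    have hf1 : ∀ x, ev x (f x) ≠ 0 := by
      intro x
      rw [map_prod]
      exact Finset.prod_ne_zero_iff.2 fun y hy => (hu x y (Finset.ne_of_mem_erase hy).symm).1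
    apply card_le_finrank_fib f
    rw [Fintype.linearIndependent_iff]
    intro g hg x
    have h1 := congrArg (ev x) hg
    rw [map_sum, map_zero, Finset.sum_eq_single x] at h1
    · rw [map_smul, smul_eq_mul] at h1
      exact (mul_eq_zero.1 h1).resolve_right (hf1 x)
    · intro y _ hyx
      rw [map_smul, hf0 y x hyx, smul_zero]
    · intro h
      exact absurd (Finset.mem_univ x) h

end Abstract

/-- Existence of a big quotient. -/
theorem lower_bound (a e : ι → ℂ) (he : Function.Injective e) (d : ℕ) (c : ι → ℕ)
    (hc : ∑ j, c j = d) :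
    ∃ (Q : Type) (_ : CommRing Q) (_ : Algebra ℂ Q) (t : Fin d → Q),
      Algebra.adjoin ℂ (Set.range t) = ⊤ ∧
      (∀ n, ∀ J : Finset (Fin d), J.card + n = d →
        cPoly Q (fun j => algebraMap ℂ Q (a j)) c n ∣ tPoly t J) ∧
      (Module.Finite ℂ Q → Nat.multinomial Finset.univ c ≤ Module.finrank ℂ Q) := by
  let b : ι → (Polynomial ℂ) := fun j => Polynomial.C (a j) + Polynomial.C (e j) * Polynomial.X
  have hb : Function.Injective b := by
    intro i j h
    have := congrArg (fun p => Polynomial.coeff p 1) h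
    simp only [b, Polynomial.coeff_add, Polynomial.coeff_C_mul, Polynomial.coeff_X_one,
      Polynomial.coeff_C_succ] at this
    exact he (by simpa using this)
  let T0 : Fin d → (Pts d c → (Polynomial ℂ)) := fun i x => b (x.1 i)
  let M := Algebra.adjoin (Polynomial ℂ) (Set.range T0)
  let T : Fin d → M := fun i => ⟨T0 i, Algebra.subset_adjoin ⟨i, rfl⟩⟩
  have hT : Algebra.adjoin (Polynomial ℂ) (Set.range T) = ⊤ := by
    have h1 := Algebra.adjoin_adjoin_coe_preimage (R := (Polynomial ℂ)) (s := Set.range T0)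
    rw [← h1]
    congr 1
    ext m
    constructor
    · rintro ⟨i, rfl⟩
      exact ⟨i, rfl⟩
    · rintro ⟨i, hi⟩
      exact ⟨i, Subtype.ext hi⟩
  let ev : Pts d c → (M →ₐ[(Polynomial ℂ)] (Polynomial ℂ)) := fun x => (Pi.evalAlgHom (Polynomial ℂ) (fun _ => (Polynomial ℂ)) x).comp M.val
  have hev : ∀ m : M, (∀ x, ev x m = 0) → m = 0 := by
    intro m h
    apply Subtype.ext
    funext x
    exact h x
  have hevT : ∀ x i, ev x (T i) = b (x.1 i) := fun x i => rfl
  have hfin : Module.Finite (Polynomial ℂ) M := by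
    have : IsNoetherian (Polynomial ℂ) (Subalgebra.toSubmodule M) := inferInstance
    exact Module.Finite.of_fg (IsNoetherian.noetherian (Subalgebra.toSubmodule M))
  exact lower_abs a e d c hc b hb rfl T hT ev hev hevT

end Lower

/-! ### Part 4: assembly -/

section Assembly

lemma lowerSet_eq_range (s : Finset ℕ) (h : ∀ i ∈ s, ∀ k ≤ i, k ∈ s) : s = Finset.range s.card := by
  refine Finset.eq_of_subset_of_card_le ?_ (by simp)
  intro i hi
  have : Finset.range (i + 1) ⊆ s := fun k hk => h i hi k (by simpa [Nat.lt_succ_iff] using hk)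
  have := Finset.card_le_card this
  simp only [Finset.card_range, Finset.mem_range] at *
  omega

lemma list_drop_prod {M : Type} [CommMonoid M] (g : ℕ → M) (ℓ n : ℕ) :
    (((List.range ℓ).drop n).map g).prod = ∏ i ∈ Finset.Ico n ℓ, g i := by
  have : (List.range ℓ).drop n = List.range' n (ℓ - n) := by
    rw [List.range_eq_range', List.drop_range']
    simp
  rw [this]
  rfl

lemma list_range_prod {M : Type} [CommMonoid M] (g : ℕ → M) (k : ℕ) :
    ((List.range k).map g).prod = ∏ i ∈ Finset.range k, g i := rfl

variable {d ℓ : ℕ} {lam : ℕ → ℕ}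

lemma card_filter_Ico (hpart : IsPartitionOf d ℓ lam) (n j : ℕ) :
    ((Finset.Ico n ℓ).filter fun i => j < lam i).card = lamT ℓ lam (j + 1) - n := by
  have h1 := lowerSet_eq_range ((Finset.range ℓ).filter fun i => j + 1 ≤ lam i) (by
    intro i hi k hk
    simp only [Finset.mem_filter, Finset.mem_range] at hi ⊢
    have := hpart.2.1 k i hk
    omega)
  have h2 : ((Finset.Ico n ℓ).filter fun i => j < lam i) = Finset.Ico n (lamT ℓ lam (j + 1)) := by
    ext i
    have h3 : i ∈ (Finset.range ℓ).filter (fun i => j + 1 ≤ lam i) ↔ i < lamT ℓ lam (j + 1) := by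
      rw [h1, Finset.mem_range]
      rfl
    simp only [Finset.mem_filter, Finset.mem_range, Finset.mem_Ico] at h3 ⊢
    rw [← h3]
    constructor
    · rintro ⟨⟨h1, h2⟩, h3⟩; exact ⟨h1, h2, h3⟩
    · rintro ⟨h1, h2, h3⟩; exact ⟨⟨h1, h2⟩, h3⟩
  rw [h2, Nat.card_Ico]

/-- Column lengths. -/
abbrev colLen (ℓ : ℕ) (lam : ℕ → ℕ) : Fin (lam 0) → ℕ := fun j => lamT ℓ lam (j.1 + 1)

lemma prod_rows {M : Type} [CommMonoid M] (hpart : IsPartitionOf d ℓ lam) (n : ℕ) (g : ℕ → M) :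
    ∏ i ∈ Finset.Ico n ℓ, ∏ j ∈ Finset.range (lam i), g j =
      ∏ j : Fin (lam 0), g j ^ (colLen ℓ lam j - n) := by
  have h1 : ∀ i ∈ Finset.Ico n ℓ, ∏ j ∈ Finset.range (lam i), g j =
      ∏ j ∈ Finset.range (lam 0), if j < lam i then g j else 1 := by
    intro i _
    rw [← Finset.prod_filter]
    refine Finset.prod_congr ?_ fun _ _ => rfl
    ext j
    have := hpart.2.1 0 i (Nat.zero_le _)
    simp only [Finset.mem_range, Finset.mem_filter]
    omega
  rw [Finset.prod_congr rfl h1, Finset.prod_comm, Finset.prod_range]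
  refine Finset.prod_congr rfl fun j _ => ?_
  rw [← Finset.prod_filter, Finset.prod_const, card_filter_Ico hpart]

lemma sum_colLen (hpart : IsPartitionOf d ℓ lam) : ∑ j, colLen ℓ lam j = d := by
  have h := prod_rows hpart 0 (fun _ => Multiplicative.ofAdd (1 : ℕ))
  have h2 := congrArg Multiplicative.toAdd h
  simp only [toAdd_prod, toAdd_pow, toAdd_ofAdd, Finset.sum_const, Finset.card_range,
    smul_eq_mul, mul_one, Nat.sub_zero] at h2
  rw [← h2, Nat.Ico_zero_eq_range]
  exact hpart.2.2.2.2

lemma lPoly_aTuple {R : Type} [CommRing R] [Algebra ℂ R] (hpart : IsPartitionOf d ℓ lam)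
    (a : ℕ → ℂ) (n : ℕ) :
    lPoly R (aTuple ℓ lam a n) =
      cPoly R (fun j : Fin (lam 0) => algebraMap ℂ R (a j)) (colLen ℓ lam) n := by
  rw [cPoly, ← prod_rows hpart n fun j => Polynomial.X - Polynomial.C (algebraMap ℂ R (a j)),
    ← list_drop_prod, lPoly, aTuple, List.map_flatMap, List.flatMap_def, List.prod_flatten,
    List.map_map]
  congr 1
  apply List.map_congr_left
  intro i _
  simp only [Function.comp_apply, List.map_map]
  rw [← list_range_prod]
  rfl

lemma length_aTuple (a : ℕ → ℂ) (n : ℕ) : (aTuple ℓ lam a n).length = mRem ℓ lam n := by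
  rw [aTuple, List.length_flatMap, mRem]
  have h := list_drop_prod (fun i => Multiplicative.ofAdd (lam i)) ℓ n
  have h2 := congrArg Multiplicative.toAdd h
  simpa [toAdd_prod, toAdd_list_sum, Function.comp_def] using h2

lemma mRem_bound (hpart : IsPartitionOf d ℓ lam) (n : ℕ) (hn : n ≤ ℓ) : mRem ℓ lam n + n ≤ d := by
  have h1 := hpart.2.2.2.2
  rw [← Finset.sum_range_add_sum_Ico _ hn] at h1
  have h2 : n ≤ ∑ i ∈ Finset.range n, lam i := by
    calc n = ∑ i ∈ Finset.range n, 1 := by simp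
      _ ≤ _ := Finset.sum_le_sum fun i hi => hpart.2.2.1 i (by
        have := Finset.mem_range.1 hi; omega)
  rw [mRem]
  omega

lemma gens_iff {R : Type} [CommRing R] [Algebra ℂ R] (hpart : IsPartitionOf d ℓ lam)
    (a : ℕ → ℂ) (t : Fin d → R) :
    (∀ g ∈ tanIdeal d ℓ lam a, aeval t g = 0) ↔
    ∀ n, ∀ J : Finset (Fin d), J.card + n = d →
      cPoly R (fun j : Fin (lam 0) => algebraMap ℂ R (a j)) (colLen ℓ lam) n ∣ tPoly t J := by
  constructor
  · intro h n J hJ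
    rw [← lPoly_aTuple hpart]
    rcases lt_or_ge n ℓ with hn | hn
    · have hb := mRem_bound hpart n hn.le
      rw [dvd_iff_gen _ _ _ _ _ _ _ (by rw [length_aTuple]; omega)]
      intro r hr1 hr2
      rw [length_aTuple] at hr1
      apply h
      apply Ideal.subset_span
      exact ⟨n, J, r, hn, by omega, by omega, by omega, rfl⟩
    · have : aTuple ℓ lam a n = [] := by
        rw [← List.length_eq_zero_iff, length_aTuple, mRem, Finset.Ico_eq_empty_of_le hn]
        simp
      rw [this]
      simp [lPoly]
  · intro h
    have hle : tanIdeal d ℓ lam a ≤ RingHom.ker (aeval t : MvPolynomial (Fin d) ℂ →ₐ[ℂ] R) := by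
      rw [tanIdeal, Ideal.span_le]
      rintro g ⟨n, J, r, hn, hJ, hr1, hr2, rfl⟩
      have hb := mRem_bound hpart n hn.le
      have h1 := h n J (by omega)
      rw [← lPoly_aTuple hpart, dvd_iff_gen _ _ _ _ _ _ _ (by rw [length_aTuple]; omega)] at h1
      exact h1 r (by rw [length_aTuple]; omega) (by omega)
    intro g hg
    exact hle hg

lemma upper_main (hpart : IsPartitionOf d ℓ lam) (a : ℕ → ℂ) :
    Module.rank ℂ (TGPAlg d ℓ lam a) ≤
      (Nat.multinomial Finset.univ (colLen ℓ lam) : Cardinal) := by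
  let q : MvPolynomial (Fin d) ℂ →ₐ[ℂ] TGPAlg d ℓ lam a := Ideal.Quotient.mkₐ ℂ _
  have hqs : Function.Surjective q := Ideal.Quotient.mkₐ_surjective ℂ _
  let t : Fin d → TGPAlg d ℓ lam a := fun i => q (X i)
  have hqt : aeval t = q := by
    ext i
    simp [t]
  have hdvd := (gens_iff hpart a t).1 (by
    intro g hg
    rw [hqt]
    exact Ideal.Quotient.eq_zero_iff_mem.2 hg)
  let tN : ℕ → TGPAlg d ℓ lam a := fun i => if h : i < d then t ⟨i, h⟩ else 0
  have htN : ∀ i : Fin d, tN i = t i := fun i => by simp [tN]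
  refine upper_bound (fun j : Fin (lam 0) => a j) d (colLen ℓ lam) (sum_colLen hpart) _ tN ?_ ?_
  · have h1 : tN '' {i | i < d} = Set.range t := by
      ext x
      constructor
      · rintro ⟨i, hi, rfl⟩
        exact ⟨⟨i, hi⟩, (htN ⟨i, hi⟩).symm⟩
      · rintro ⟨i, rfl⟩
        exact ⟨i, i.2, htN i⟩
    rw [h1, Algebra.adjoin_range_eq_range_aeval, hqt, AlgHom.range_eq_top]
    exact hqs
  · intro n J hJ hn
    have hJ' : ∀ i ∈ J, i < d := fun i hi => Finset.mem_range.1 (hJ hi)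
    have h2 : tPoly tN J = tPoly t (J.attachFin hJ') := by
      conv_lhs => rw [← Finset.map_valEmbedding_attachFin hJ']
      rw [tPoly, tPoly, Finset.prod_map]
      refine Finset.prod_congr rfl fun i _ => ?_
      rw [← htN i]
      rfl
    rw [h2]
    exact hdvd n _ (by rw [Finset.card_attachFin]; exact hn)

end Assembly

/-- For every sequence of evaluation parameters `a`, the deformed
Tanisaki–Garsia–Procesi algebra `R_a(λ)` is finite dimensional over `ℂ` of dimension
exactly `d! / ((λ^t_1)! ⋯ (λ^t_p)!)`; in particular independent of `a`. -/
theorem deformed_TGP_dim (d ℓ : ℕ) (lam : ℕ → ℕ) (hpart : IsPartitionOf d ℓ lam)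
    (a : ℕ → ℂ) :
    FiniteDimensional ℂ (TGPAlg d ℓ lam a) ∧
    Module.finrank ℂ (TGPAlg d ℓ lam a) =
      Nat.factorial d / ∏ i ∈ Finset.range (lam 0), Nat.factorial (lamT ℓ lam (i + 1)) := by
  have hup := upper_main hpart a
  have hfin : FiniteDimensional ℂ (TGPAlg d ℓ lam a) :=
    Module.rank_lt_aleph0_iff.1 (hup.trans_lt Cardinal.natCast_lt_aleph0)
  refine ⟨hfin, ?_⟩
  have hmul : Nat.multinomial Finset.univ (colLen ℓ lam) =
      Nat.factorial d / ∏ i ∈ Finset.range (lam 0), Nat.factorial (lamT ℓ lam (i + 1)) := by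
    rw [Nat.multinomial, sum_colLen hpart, Finset.prod_range]
  rw [← hmul]
  apply le_antisymm
  · rw [← Module.finrank_eq_rank] at hup
    exact_mod_cast hup
  · obtain ⟨Q, _, _, t, hgen, hdvd, hdim⟩ := lower_bound (fun j : Fin (lam 0) => a j)
      (fun j : Fin (lam 0) => ((j : ℕ) : ℂ))
      (fun i j h => Fin.ext (Nat.cast_injective h)) d (colLen ℓ lam) (sum_colLen hpart)
    have hker := (gens_iff hpart a t).2 hdvd
    let φ : TGPAlg d ℓ lam a →ₐ[ℂ] Q := Ideal.Quotient.liftₐ _ (aeval t) hker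
    have hφ : Function.Surjective φ := by
      intro x
      have hx : x ∈ Algebra.adjoin ℂ (Set.range t) := by rw [hgen]; trivial
      rw [Algebra.adjoin_range_eq_range_aeval] at hx
      obtain ⟨p, hp⟩ := hx
      exact ⟨Ideal.Quotient.mk _ p, hp⟩
    have hQ : Module.Finite ℂ Q := Module.Finite.of_surjective φ.toLinearMap hφ
    exact (hdim hQ).trans (LinearMap.finrank_le_finrank_of_surjective (f := φ.toLinearMap) hφ)

end
end

section
/- For every a ∈ ℂ^p and every permutation σ ∈ S_d, the trace of the ℂ-linear endomorphism of R_a(λ) induced by the algebra automorphism of ℂ[t_1, …, t_d] sending t_j ↦ t_{σ(j)} equals the number of functions φ : {1, …, d} → {1, …, p} such that #φ^{-1}(i) = λ^t_i for all 1 ≤ i ≤ p and φ(σ(j)) = φ(j) for all 1 ≤ j ≤ d. (In particular, the character of the S_d-action on R_a(λ) is the permutation character of S_d on fillings with column multiplicities λ^t and is independent of a.) -/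
open MvPolynomial

noncomputable section

section CoreLemma
open scoped Polynomial

lemma natDegree_multi_le {S : Type*} [CommRing S] (l : Multiset S) :
    (l.map fun x => (Polynomial.X - Polynomial.C x : S[X])).prod.natDegree ≤ l.card := by
  refine (Polynomial.natDegree_multiset_prod_le _).trans ?_
  rw [Multiset.map_map]
  have := Multiset.sum_le_card_nsmul (l.map (Polynomial.natDegree ∘ fun x => (Polynomial.X - Polynomial.C x : S[X]))) 1
    (by
      intro x hx
      obtain ⟨y, _, rfl⟩ := Multiset.mem_map.1 hx
      exact Polynomial.natDegree_X_sub_C_le y)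
  simpa using this

lemma reflect_multi {S : Type*} [CommRing S] (l : Multiset S) :
    Polynomial.reflect l.card (l.map fun x => (Polynomial.X - Polynomial.C x : S[X])).prod =
      (l.map fun x => (1 - Polynomial.C x * Polynomial.X : S[X])).prod := by
  induction l using Multiset.induction with
  | empty => simp
  | cons x l ih =>
    rw [Multiset.map_cons, Multiset.prod_cons, Multiset.map_cons, Multiset.prod_cons,
      Multiset.card_cons, add_comm,
      Polynomial.reflect_mul _ _ (Polynomial.natDegree_X_sub_C_le x) (natDegree_multi_le l), ih]
    simp [Polynomial.reflect_sub]

lemma natDegree_reflect_le' {S : Type*} [CommRing S] {N : ℕ} {p : S[X]} (h : p.natDegree ≤ N) :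
    (Polynomial.reflect N p).natDegree ≤ N :=
  Polynomial.natDegree_reflect_le.trans (by simp [h])

/-- Divisibility of products of linear factors, in terms of coefficients of a power series. -/
lemma core_iff {S : Type*} [CommRing S] (l b : Multiset S) (hc : b.card ≤ l.card)
    (H : PowerSeries S)
    (hH : H * (((b.map fun x => (1 - Polynomial.C x * Polynomial.X : S[X])).prod : S[X]) : PowerSeries S) = 1) :
    ((b.map fun x => (Polynomial.X - Polynomial.C x : S[X])).prod ∣
      (l.map fun x => (Polynomial.X - Polynomial.C x : S[X])).prod) ↔
    ∀ r, l.card - b.card < r → r ≤ l.card →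
      PowerSeries.coeff r
        ((((l.map fun x => (1 - Polynomial.C x * Polynomial.X : S[X])).prod : S[X]) : PowerSeries S) * H) = 0 := by
  set D := (b.map fun x => (Polynomial.X - Polynomial.C x : S[X])).prod with hD
  set P := (l.map fun x => (Polynomial.X - Polynomial.C x : S[X])).prod with hP
  have hDm : D.Monic := Polynomial.monic_multiset_prod_of_monic _ _ fun x _ => Polynomial.monic_X_sub_C x
  have hDd : D.natDegree ≤ b.card := natDegree_multi_le b
  have hPd : P.natDegree ≤ l.card := natDegree_multi_le l
  rw [← reflect_multi, ← hD] at hH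
  rw [← reflect_multi, ← hP]
  obtain ⟨e, he⟩ := Nat.exists_eq_add_of_le hc
  have hH' : (Polynomial.reflect b.card D : PowerSeries S) * H = 1 := by rw [mul_comm]; exact hH
  constructor
  · rintro ⟨Q, hQ⟩ r hr1 hr2
    nontriviality S
    have hQd : Q.natDegree ≤ e := by
      have h1 : P.natDegree = D.natDegree + Q.natDegree := by
        rw [hQ]; exact hDm.natDegree_mul' (by
          rintro rfl
          have : P.Monic := Polynomial.monic_multiset_prod_of_monic _ _ fun x _ => Polynomial.monic_X_sub_C x
          rw [hQ, mul_zero] at this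
          exact Polynomial.not_monic_zero this)
      have h2 : D.natDegree = b.card := by
        rw [hD]; simp
      omega
    rw [he, hQ, Polynomial.reflect_mul _ _ hDd hQd, mul_comm (Polynomial.reflect _ D),
      Polynomial.coe_mul, mul_assoc, hH', mul_one, Polynomial.coeff_coe]
    apply Polynomial.coeff_eq_zero_of_natDegree_lt
    have := natDegree_reflect_le' hQd
    omega
  · intro h
    set G : PowerSeries S := (Polynomial.reflect l.card P : PowerSeries S) * H with hG
    set Qt : S[X] := PowerSeries.trunc (e + 1) G with hQt
    have hQtd : Qt.natDegree ≤ e := by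
      exact Nat.lt_succ_iff.1 (PowerSeries.natDegree_trunc_lt G e)
    have hPG : (Polynomial.reflect l.card P : PowerSeries S) = (Polynomial.reflect b.card D : PowerSeries S) * G := by
      rw [hG, mul_left_comm, hH', mul_one]
    have hdiv : (PowerSeries.X : PowerSeries S) ^ (l.card + 1) ∣ G - (Qt : PowerSeries S) := by
      rw [PowerSeries.X_pow_dvd_iff]
      intro m hm
      rw [map_sub, Polynomial.coeff_coe, hQt, PowerSeries.coeff_trunc]
      split_ifs with h1
      · simp
      · rw [h m (by omega) (by omega)]; simp
    have hPQ : Polynomial.reflect l.card P = Polynomial.reflect b.card D * Qt := by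
      ext m
      by_cases hm : m ≤ l.card
      · have h3 : (PowerSeries.X : PowerSeries S) ^ (l.card + 1) ∣
            ((Polynomial.reflect l.card P - Polynomial.reflect b.card D * Qt : S[X]) : PowerSeries S) := by
          rw [Polynomial.coe_sub, Polynomial.coe_mul, hPG, ← mul_sub]
          exact Dvd.dvd.mul_left hdiv _
        have := (PowerSeries.X_pow_dvd_iff.1 h3) m (by omega)
        rw [Polynomial.coeff_coe, Polynomial.coeff_sub] at this
        exact sub_eq_zero.1 this
      · have h1 := natDegree_reflect_le' hPd
        have h2 := natDegree_reflect_le' hDd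
        have h3 := Polynomial.natDegree_mul_le (p := Polynomial.reflect b.card D) (q := Qt)
        rw [Polynomial.coeff_eq_zero_of_natDegree_lt (by omega),
          Polynomial.coeff_eq_zero_of_natDegree_lt (by omega)]
    refine ⟨Polynomial.reflect e Qt, ?_⟩
    have := congrArg (Polynomial.reflect l.card) hPQ
    rw [Polynomial.reflect_reflect] at this
    rw [this, he, Polynomial.reflect_mul _ _ (natDegree_reflect_le' hDd) hQtd, Polynomial.reflect_reflect]

end CoreLemma

section SpanBound
open scoped Polynomial

/-- The polynomial `∏ (z - a_i)^{max(c_i - n, 0)}`. -/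
def DP {S ι : Type*} [CommRing S] [Fintype ι] (c : ι → ℕ) (a : ι → S) (n : ℕ) : S[X] :=
  ∏ i, (Polynomial.X - Polynomial.C (a i)) ^ (c i - n)

/-- The Tanisaki conditions, as divisibility conditions. -/
def Tan {S ι : Type*} [CommRing S] [Fintype ι] (c : ι → ℕ) (a : ι → S) {d : ℕ}
    (t : Fin d → S) : Prop :=
  ∀ J : Finset (Fin d), DP c a (d - J.card) ∣ ∏ j ∈ J, (Polynomial.X - Polynomial.C (t j))

/-- Fillings of content `c`. -/
abbrev Fill {ι : Type*} (d : ℕ) (c : ι → ℕ) :=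
  {φ : Fin d → ι // ∀ i, Nat.card {j : Fin d // φ j = i} = c i}

lemma DP_monic {S ι : Type*} [CommRing S] [Fintype ι] (c : ι → ℕ) (a : ι → S) (n : ℕ) :
    (DP c a n).Monic :=
  Polynomial.monic_prod_of_monic _ _ fun i _ => (Polynomial.monic_X_sub_C _).pow _

lemma DP_map {S S' ι : Type*} [CommRing S] [CommRing S'] [Fintype ι] (f : S →+* S') (c : ι → ℕ)
    (a : ι → S) (n : ℕ) : (DP c a n).map f = DP c (fun i => f (a i)) n := by
  simp [DP, Polynomial.map_prod]

lemma prodlin_map {S S' ι : Type*} [CommRing S] [CommRing S'] (f : S →+* S') (s : Finset ι)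
    (t : ι → S) : (∏ j ∈ s, (Polynomial.X - Polynomial.C (t j))).map f =
      ∏ j ∈ s, (Polynomial.X - Polynomial.C (f (t j))) := by
  simp [Polynomial.map_prod]

lemma Tan.map {S S' ι : Type*} [CommRing S] [CommRing S'] [Fintype ι] {c : ι → ℕ}
    {a : ι → S} {d : ℕ} {t : Fin d → S} (h : Tan c a t) (f : S →+* S') :
    Tan c (fun i => f (a i)) (fun j => f (t j)) := by
  intro J
  have := Polynomial.map_dvd f (h J)
  rwa [DP_map, prodlin_map] at this

lemma DP_succ {S ι : Type*} [CommRing S] [Fintype ι] (c : ι → ℕ) (a : ι → S) (n : ℕ) :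
    DP c a n = DP c a (n + 1) *
      ∏ j ∈ Finset.univ.filter (fun j => n < c j), (Polynomial.X - Polynomial.C (a j)) := by
  rw [DP, DP, Finset.prod_filter, ← Finset.prod_mul_distrib]
  refine Finset.prod_congr rfl fun j _ => ?_
  split_ifs with h
  · rw [← pow_succ]; congr 1; omega
  · rw [mul_one]; congr 1; omega

lemma DP_update_le {S ι : Type*} [CommRing S] [Fintype ι] [DecidableEq ι] (c : ι → ℕ) (a : ι → S)
    (n : ℕ) (i : ι) (h : c i ≤ n) : DP (Function.update c i (c i - 1)) a n = DP c a n := by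
  refine Finset.prod_congr rfl fun j _ => ?_
  by_cases hj : j = i
  · subst hj
    rw [Function.update_self]; congr 1; omega
  · rw [Function.update_of_ne hj]

lemma DP_update_gt {S ι : Type*} [CommRing S] [Fintype ι] [DecidableEq ι] (c : ι → ℕ) (a : ι → S)
    (n : ℕ) (i : ι) (h : n < c i) : DP (Function.update c i (c i - 1)) a n = DP c a (n + 1) *
      ∏ j ∈ Finset.univ.filter (fun j => n < c j ∧ j ≠ i), (Polynomial.X - Polynomial.C (a j)) := by
  rw [DP, DP, Finset.prod_filter, ← Finset.prod_mul_distrib]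
  refine Finset.prod_congr rfl fun j _ => ?_
  by_cases hj : j = i
  · subst hj
    rw [Function.update_self]; simp; congr 1; omega
  · rw [Function.update_of_ne hj]
    split_ifs with h1
    · rw [← pow_succ]; congr 1; omega
    · rw [mul_one]; congr 1
      have : ¬ n < c j := fun h' => h1 ⟨h', hj⟩
      omega

lemma monic_prodlin {S ι : Type*} [CommRing S] (s : Finset ι) (a : ι → S) :
    (∏ j ∈ s, (Polynomial.X - Polynomial.C (a j))).Monic :=
  Polynomial.monic_prod_of_monic _ _ fun _ _ => Polynomial.monic_X_sub_C _

lemma eval_prodlin {S ι : Type*} [CommRing S] (s : Finset ι) (a : ι → S) (t : S) :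
    (∏ j ∈ s, (Polynomial.X - Polynomial.C (a j))).eval t = ∏ j ∈ s, (t - a j) := by
  simp [Polynomial.eval_prod]

lemma monic_dvd_cancel {S : Type*} [CommRing S] {D f g : S[X]} (hD : D.Monic)
    (h : D * f ∣ D * g) : f ∣ g := by
  obtain ⟨q, hq⟩ := h
  refine ⟨q, hD.isRegular.left ?_⟩
  simpa [mul_assoc] using hq

lemma Tan.tail {S ι : Type*} [CommRing S] [Fintype ι] {c : ι → ℕ}
    {a : ι → S} {d : ℕ} {t : Fin (d + 1) → S} (h : Tan c a t) (J : Finset (Fin d)) :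
    DP c a (d - J.card + 1) ∣ ∏ j ∈ J, (Polynomial.X - Polynomial.C (t j.succ)) := by
  have h1 := h (J.map (Fin.succEmb d))
  rw [Finset.card_map, Finset.prod_map] at h1
  have : J.card ≤ d := by simpa using Finset.card_le_univ J
  rwa [show d + 1 - J.card = d - J.card + 1 by omega] at h1

lemma Tan.cons {S ι : Type*} [CommRing S] [Fintype ι] {c : ι → ℕ}
    {a : ι → S} {d : ℕ} {t : Fin (d + 1) → S} (h : Tan c a t) (J : Finset (Fin d)) :
    DP c a (d - J.card) ∣ (∏ j ∈ J, (Polynomial.X - Polynomial.C (t j.succ))) *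
      (Polynomial.X - Polynomial.C (t 0)) := by
  have h1 := h (Finset.cons 0 (J.map (Fin.succEmb d)) (by simp [Fin.succ_ne_zero]))
  rw [Finset.card_cons, Finset.prod_cons, Finset.card_map, Finset.prod_map] at h1
  rw [mul_comm]
  rwa [show d + 1 - (J.card + 1) = d - J.card by omega] at h1

lemma f_zero {S ι : Type*} [CommRing S] [Fintype ι] {c : ι → ℕ}
    {a : ι → S} {d : ℕ} {t : Fin (d + 1) → S} (h : Tan c a t) (hc : ∑ i, c i = d + 1)
    (T : Finset ι) (hT : ∀ j, j ∉ T → c j = 0) : ∏ j ∈ T, (t 0 - a j) = 0 := by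
  classical
  nontriviality S
  obtain ⟨Q, hQ⟩ := h.tail Finset.univ
  have h0 := h.cons Finset.univ
  simp only [Finset.card_univ, Fintype.card_fin, Nat.sub_self, zero_add] at hQ h0
  have heq : ((∏ j : Fin d, (Polynomial.X - Polynomial.C (t j.succ))) *
      (Polynomial.X - Polynomial.C (t 0))) = DP c a 0 := by
    refine Polynomial.eq_of_monic_of_dvd_of_natDegree_le (DP_monic _ _ _)
      ((monic_prodlin _ _).mul (Polynomial.monic_X_sub_C _)) h0 ?_
    rw [(monic_prodlin _ _).natDegree_mul (Polynomial.monic_X_sub_C _), DP,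
      Polynomial.natDegree_prod_of_monic _ _ (fun i _ => (Polynomial.monic_X_sub_C _)),
      Polynomial.natDegree_prod_of_monic _ _ (fun i _ => (Polynomial.monic_X_sub_C _).pow _)]
    simp only [Polynomial.natDegree_X_sub_C, (Polynomial.monic_X_sub_C _).natDegree_pow]
    simp [hc]
  rw [hQ, DP_succ c a 0, mul_assoc] at heq
  have h2 := (DP_monic c a 1).isRegular.left heq
  have h3 := congrArg (Polynomial.eval (t 0)) h2
  rw [eval_prodlin] at h3
  simp only [Polynomial.eval_mul, Polynomial.eval_sub, Polynomial.eval_X, Polynomial.eval_C, sub_self, mul_zero] at h3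
  have hsub : Finset.univ.filter (fun j => 0 < c j) ⊆ T := by
    intro j hj
    by_contra hn
    have := hT j hn
    simp [this] at hj
  rw [← Finset.prod_sdiff hsub, ← h3, mul_zero]

lemma step_key {S ι : Type*} [CommRing S] [Fintype ι] [DecidableEq ι] {c : ι → ℕ}
    {a : ι → S} {d : ℕ} {t : Fin (d + 1) → S} (h : Tan c a t) (T : Finset ι) (i : ι) (hi : i ∉ T)
    (h1 : ∀ j ∈ T, c i ≤ c j) (h2 : ∀ j, j ∉ insert i T → c j ≤ c i)
    (hz : ∏ j ∈ insert i T, (t 0 - a j) = 0) (J : Finset (Fin d)) :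
    DP (Function.update c i (c i - 1)) a (d - J.card) ∣
      Polynomial.C (∏ j ∈ T, (t 0 - a j)) *
        ∏ j ∈ J, (Polynomial.X - Polynomial.C (t j.succ)) := by
  set n := d - J.card with hn
  obtain ⟨Q, hQ⟩ := h.tail J
  have h0 := h.cons J
  rw [hQ] at h0 ⊢
  rw [← hn] at h0 ⊢
  rw [DP_succ, mul_assoc] at h0
  have h3 := monic_dvd_cancel (DP_monic _ _ _) h0
  set F := ∏ j ∈ Finset.univ.filter (fun j => n < c j), (Polynomial.X - Polynomial.C (a j)) with hF
  have key : ∀ f : S[X], F ∣ Q * f - Q * Polynomial.C (f.eval (t 0)) := by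
    intro f
    rw [← mul_sub]
    exact h3.trans (mul_dvd_mul_left _ Polynomial.X_sub_C_dvd_sub_C_eval)
  rw [mul_left_comm]
  by_cases hci : c i ≤ n
  · rw [DP_update_le _ _ _ _ hci, DP_succ]
    refine mul_dvd_mul_left _ ?_
    have := key (∏ j ∈ T, (Polynomial.X - Polynomial.C (a j)))
    rw [eval_prodlin] at this
    have hFT : F ∣ ∏ j ∈ T, (Polynomial.X - Polynomial.C (a j)) := by
      refine Finset.prod_dvd_prod_of_subset _ _ _ ?_
      intro j hj
      simp only [Finset.mem_filter, Finset.mem_univ, true_and] at hj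
      by_contra hjT
      have hji : j ≠ i := by rintro rfl; omega
      have := h2 j (by simp [hji, hjT])
      omega
    rw [mul_comm]
    exact (dvd_sub_right (hFT.mul_left Q)).1 this
  · push Not at hci
    rw [DP_update_gt _ _ _ _ hci]
    refine mul_dvd_mul_left _ ?_
    set R := (Finset.univ.filter (fun j => n < c j)) \ insert i T with hR
    have hsub : insert i T ⊆ Finset.univ.filter (fun j => n < c j) := by
      intro j hj
      simp only [Finset.mem_filter, Finset.mem_univ, true_and]
      rcases Finset.mem_insert.1 hj with rfl | hj
      · exact hci
      · exact lt_of_lt_of_le hci (h1 j hj)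
    have hFR : F = (∏ j ∈ insert i T, (Polynomial.X - Polynomial.C (a j))) *
        ∏ j ∈ R, (Polynomial.X - Polynomial.C (a j)) := by
      rw [hF, ← Finset.prod_sdiff hsub, mul_comm]
    have hU : (∏ j ∈ Finset.univ.filter (fun j => n < c j ∧ j ≠ i), (Polynomial.X - Polynomial.C (a j))) =
        (∏ j ∈ T, (Polynomial.X - Polynomial.C (a j))) *
        ∏ j ∈ R, (Polynomial.X - Polynomial.C (a j)) := by
      rw [← Finset.prod_union]
      · congr 1
        ext j
        simp only [Finset.mem_filter, Finset.mem_univ, true_and, hR, Finset.mem_union,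
          Finset.mem_sdiff, Finset.mem_insert]
        constructor
        · rintro ⟨h5, h6⟩
          by_cases hj : j ∈ T
          · exact Or.inl hj
          · exact Or.inr ⟨h5, by simp [h6, hj]⟩
        · rintro (h5 | ⟨h5, h6⟩)
          · exact ⟨lt_of_lt_of_le hci (h1 j h5), by rintro rfl; exact hi h5⟩
          · exact ⟨h5, fun h7 => h6 (Or.inl h7)⟩
      · rw [Finset.disjoint_right]
        intro j hj hjT
        simp only [hR, Finset.mem_sdiff] at hj
        exact hj.2 (Finset.mem_insert_of_mem hjT)
    have k1 := key (∏ j ∈ insert i T, (Polynomial.X - Polynomial.C (a j)))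
    rw [eval_prodlin, hz, map_zero, mul_zero, sub_zero, hFR, mul_comm Q] at k1
    have hRQ := monic_dvd_cancel (monic_prodlin _ _) k1
    have k2 := key (∏ j ∈ T, (Polynomial.X - Polynomial.C (a j)))
    rw [eval_prodlin] at k2
    rw [hU]
    have hd : (∏ j ∈ T, (Polynomial.X - Polynomial.C (a j))) *
        (∏ j ∈ R, (Polynomial.X - Polynomial.C (a j))) ∣ F := by
      rw [hFR, Finset.prod_insert hi, mul_assoc]
      exact Dvd.dvd.mul_left dvd_rfl _
    have k3 := hd.trans k2
    rw [mul_comm (Polynomial.C _)]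
    refine (dvd_sub_right ?_).1 k3
    rw [mul_comm Q]
    exact mul_dvd_mul_left _ hRQ

end SpanBound

section SpanBound2
open scoped Polynomial

lemma natCard_fiber {ι : Type*} [DecidableEq ι] {d : ℕ} (φ : Fin d → ι) (i : ι) :
    Nat.card {j : Fin d // φ j = i} = (Finset.univ.filter fun j => φ j = i).card := by
  rw [Nat.card_eq_fintype_card, Fintype.card_subtype]

lemma fill_rec {ι : Type*} [Fintype ι] [DecidableEq ι] (d : ℕ) (c : ι → ℕ) :
    ∑ i, (if 0 < c i then Nat.card (Fill d (Function.update c i (c i - 1))) else 0) ≤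
      Nat.card (Fill (d + 1) c) := by
  classical
  rw [← Finset.sum_filter, Finset.sum_subtype (p := fun i => 0 < c i) _ (by simp),
    ← Nat.card_sigma]
  refine Nat.card_le_card_of_injective
    (fun x => ⟨Fin.cons x.1.1 x.2.1, ?_⟩) ?_
  · intro k
    obtain ⟨⟨i, hi⟩, ⟨ψ, hψ⟩⟩ := x
    have := hψ k
    rw [natCard_fiber] at this ⊢
    rw [Fin.card_filter_univ_succ]
    simp only [Fin.cons_zero, Fin.cons_succ]
    by_cases hk : i = k
    · subst hk
      simp at this
      rw [if_pos rfl, this]; omega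
    · rw [if_neg hk, this, Function.update_of_ne (Ne.symm hk)]
  · rintro ⟨⟨i, hi⟩, ⟨ψ, hψ⟩⟩ ⟨⟨i', hi'⟩, ⟨ψ', hψ'⟩⟩ h
    simp only [Subtype.mk.injEq] at h
    obtain ⟨h1, h2⟩ := Fin.cons_injective2 h
    subst h1
    subst h2
    rfl

lemma tan_quot {S ι : Type*} [CommRing S] [Fintype ι] (c : ι → ℕ) (a : ι → S) {d : ℕ}
    (t : Fin d → S) (f g : S) (I : Ideal S) (hI : ∀ x, f * x ∈ Ideal.span {g} → x ∈ I)
    (h : ∀ J : Finset (Fin d),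
      DP c (fun i => Ideal.Quotient.mk (Ideal.span {g}) (a i)) (d - J.card) ∣
      Polynomial.C (Ideal.Quotient.mk (Ideal.span {g}) f) *
        ∏ j ∈ J, (Polynomial.X - Polynomial.C (Ideal.Quotient.mk (Ideal.span {g}) (t j)))) :
    Tan c (fun i => Ideal.Quotient.mk I (a i)) (fun j => Ideal.Quotient.mk I (t j)) := by
  intro J
  have h1 := h J
  rw [← DP_map, ← prodlin_map, ← Polynomial.map_C, ← Polynomial.map_mul,
    ← Polynomial.modByMonic_eq_zero_iff_dvd ((DP_monic _ _ _).map _),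
    ← Polynomial.map_modByMonic _ (DP_monic _ _ _), ← Polynomial.smul_eq_C_mul,
    Polynomial.smul_modByMonic] at h1
  rw [← DP_map, ← prodlin_map, 
    ← Polynomial.modByMonic_eq_zero_iff_dvd ((DP_monic _ _ _).map _),
    ← Polynomial.map_modByMonic _ (DP_monic _ _ _)]
  ext k
  have h2 := congrArg (fun p => Polynomial.coeff p k) h1
  simp only [Polynomial.coeff_map, Polynomial.coeff_smul, Polynomial.coeff_zero, smul_eq_mul] at h2 ⊢
  rw [Ideal.Quotient.eq_zero_iff_mem] at h2 ⊢
  exact hI _ h2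

theorem span_bound {A : Type*} {ι : Type*} [CommRing A] [Fintype ι] (a : ι → A) (d : ℕ) :
    ∀ (c : ι → ℕ), ∑ i, c i = d → ∀ (S : Type*) [CommRing S] [Algebra A S] (t : Fin d → S),
      Algebra.adjoin A (Set.range t) = ⊤ → Tan c (fun i => algebraMap A S (a i)) t →
      ∃ W : Finset S, W.card ≤ Nat.card (Fill d c) ∧ Submodule.span A (W : Set S) = ⊤ := by
  classical
  induction d with
  | zero =>
    intro c hc S _ _ t ht _
    refine ⟨{1}, ?_, ?_⟩
    · have : Nonempty (Fill 0 c) := ⟨⟨Fin.elim0, fun i => by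
        have := (Finset.sum_eq_zero_iff.1 hc) i (Finset.mem_univ i)
        simp [this]⟩⟩
      rw [Finset.card_singleton]
      exact Nat.card_pos
    · rw [Set.range_eq_empty, Algebra.adjoin_empty] at ht
      rw [Finset.coe_singleton, ← Submodule.one_eq_span, ← Algebra.toSubmodule_bot, ht, Algebra.top_toSubmodule]
  | succ d ih =>
    intro c hc S _ _ t ht hTan
    set α : ι → S := fun i => algebraMap A S (a i) with hα
    let N : ι → ℕ := fun i => if 0 < c i then Nat.card (Fill d (Function.update c i (c i - 1))) else 0
    have main : ∀ T : Finset ι, (∀ j ∈ T, ∀ k, k ∉ T → c k ≤ c j) →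
        ∃ W : Finset S, W.card ≤ ∑ i ∈ T, N i ∧ ∀ x : S, ∃ y ∈ Submodule.span A (W : Set S), ∃ z,
          x = y + (∏ j ∈ T, (t 0 - α j)) * z := by
      intro T
      induction T using Finset.induction_on_min_value c with
      | empty => exact fun _ => ⟨∅, by simp, fun x => ⟨0, by simp, x, by simp⟩⟩
      | insert i s his hmin ihs =>
        intro hup
        have hout : ∀ j, j ∉ insert i s → c j ≤ c i := fun j hj =>
          hup i (Finset.mem_insert_self _ _) j hj
        obtain ⟨W, hW1, hW2⟩ := ihs (by
          intro j hj k hk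
          by_cases hki : k = i
          · subst hki; exact hmin j hj
          · exact hup j (Finset.mem_insert_of_mem hj) k (by simp [hki, hk]))
        rcases Nat.eq_zero_or_pos (c i) with hci | hci
        · refine ⟨W, hW1.trans (Finset.sum_le_sum_of_subset (Finset.subset_insert _ _)), fun x => ?_⟩
          obtain ⟨y, hy, z, hz⟩ := hW2 x
          have : ∏ j ∈ s, (t 0 - α j) = 0 := by
            refine f_zero hTan hc s fun j hj => ?_
            by_cases hji : j = i
            · rw [hji, hci]
            · have := hout j (by simp [hji, hj]); omega
          exact ⟨y, hy, 0, by rw [hz, this]; simp⟩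
        · set f := ∏ j ∈ s, (t 0 - α j) with hf
          set g := ∏ j ∈ insert i s, (t 0 - α j) with hg
          have hgf : g = f * (t 0 - α i) := by rw [hg, Finset.prod_insert his, mul_comm]
          let I : Ideal S := Submodule.comap (LinearMap.mulLeft S f) (Ideal.span {g})
          have hI : ∀ x, x ∈ I ↔ f * x ∈ Ideal.span {g} := fun x => Iff.rfl
          have hsum : ∑ k, Function.update c i (c i - 1) k = d := by
            rw [Finset.sum_update_of_mem (Finset.mem_univ i)]
            have := Finset.sum_erase_add Finset.univ c (Finset.mem_univ i)
            rw [Finset.sdiff_singleton_eq_erase]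
            omega
          have hadj : Algebra.adjoin A (Set.range fun j : Fin d => Ideal.Quotient.mk I (t j.succ)) = ⊤ := by
            have h1 := congrArg (Subalgebra.map (Ideal.Quotient.mkₐ A I)) ht
            rw [AlgHom.map_adjoin, Algebra.map_top,
              (AlgHom.range_eq_top _).2 (Ideal.Quotient.mkₐ_surjective A I)] at h1
            rw [eq_top_iff, ← h1]
            refine Algebra.adjoin_le ?_
            rintro _ ⟨_, ⟨j, rfl⟩, rfl⟩
            rcases Fin.eq_zero_or_eq_succ j with rfl | ⟨j, rfl⟩
            · have : Ideal.Quotient.mkₐ A I (t 0) = algebraMap A (S ⧸ I) (a i) := by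
                change Ideal.Quotient.mk I (t 0) = Ideal.Quotient.mk I (α i)
                rw [Ideal.Quotient.eq, hI, ← hgf]
                exact Ideal.subset_span rfl
              rw [this]
              exact Subalgebra.algebraMap_mem _ _
            · exact Algebra.subset_adjoin ⟨j, rfl⟩
          have hTan' : Tan (Function.update c i (c i - 1)) (fun k => algebraMap A (S ⧸ I) (a k))
              (fun j : Fin d => Ideal.Quotient.mk I (t j.succ)) := by
            refine tan_quot (Function.update c i (c i - 1)) α (fun j : Fin d => t j.succ) f g I
              (fun x hx => hx) ?_
            intro J
            have := step_key (hTan.map (Ideal.Quotient.mk (Ideal.span {g}))) s i his hmin hout (by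
              simp only [← map_sub, ← map_prod]
              rw [Ideal.Quotient.eq_zero_iff_mem]
              exact Ideal.subset_span rfl) J
            simp only [← map_sub, ← map_prod] at this ⊢
            exact this
          obtain ⟨W', hW'1, hW'2⟩ := ih _ hsum (S ⧸ I) _ hadj hTan'
          let out : S ⧸ I → S := fun x => f * Quotient.out x
          refine ⟨W ∪ W'.image out, ?_, ?_⟩
          · refine (Finset.card_union_le _ _).trans ?_
            rw [Finset.sum_insert his, add_comm]
            refine Nat.add_le_add ?_ hW1
            refine Finset.card_image_le.trans ?_
            simpa [N, hci] using hW'1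
          · have hlift : ∀ w : S ⧸ I, w ∈ Submodule.span A (W' : Set (S ⧸ I)) →
                ∃ v, Ideal.Quotient.mk I v = w ∧
                  f * v ∈ Submodule.span A ((W ∪ W'.image out : Finset S) : Set S) := by
              intro w hw
              induction hw using Submodule.span_induction with
              | mem x hx =>
                refine ⟨Quotient.out x, Ideal.Quotient.mk_out x, Submodule.subset_span ?_⟩
                rw [Finset.mem_coe, Finset.mem_union]
                exact Or.inr (Finset.mem_image.2 ⟨x, hx, rfl⟩)
              | zero => exact ⟨0, by simp, by simp⟩
              | add x y _ _ hx hy =>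
                obtain ⟨v, hv1, hv2⟩ := hx
                obtain ⟨v', hv1', hv2'⟩ := hy
                exact ⟨v + v', by rw [map_add, hv1, hv1'], by rw [mul_add]; exact add_mem hv2 hv2'⟩
              | smul r x _ hx =>
                obtain ⟨v, hv1, hv2⟩ := hx
                refine ⟨r • v, ?_, ?_⟩
                · rw [← hv1]; rfl
                · rw [mul_smul_comm]; exact Submodule.smul_mem _ _ hv2
            intro x
            obtain ⟨y, hy, z, hz⟩ := hW2 x
            obtain ⟨v, hv1, hv2⟩ := hlift (Ideal.Quotient.mk I z) (hW'2 ▸ Submodule.mem_top)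
            have hzv : z - v ∈ I := Ideal.Quotient.eq.1 hv1.symm
            rw [hI, Ideal.mem_span_singleton] at hzv
            obtain ⟨q, hq⟩ := hzv
            refine ⟨y + f * v, add_mem (Submodule.span_mono (by simp) hy) hv2, q, ?_⟩
            rw [← hq, hz]; ring
    obtain ⟨W, hW1, hW2⟩ := main Finset.univ (by simp)
    refine ⟨W, hW1.trans (fill_rec d c), ?_⟩
    rw [eq_top_iff]
    intro x _
    obtain ⟨y, hy, z, hz⟩ := hW2 x
    rw [f_zero hTan hc _ (by simp), zero_mul, add_zero] at hz
    rw [hz]; exact hy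

end SpanBound2

section TanIff
open scoped Polynomial

lemma down_eq_range (s : Finset ℕ) (h : ∀ x ∈ s, ∀ y < x, y ∈ s) : s = Finset.range s.card := by
  refine Finset.eq_of_subset_of_card_le ?_ (by simp)
  intro x hx
  have h1 : Finset.range (x + 1) ⊆ s := by
    intro y hy
    rcases Nat.lt_or_eq_of_le (Nat.lt_succ_iff.1 (Finset.mem_range.1 hy)) with h2 | rfl
    · exact h x hx y h2
    · exact hx
  have := Finset.card_le_card h1
  simp at this ⊢
  omega

lemma lamT_sub (ℓ : ℕ) (lam : ℕ → ℕ) (hanti : ∀ i j, i ≤ j → lam j ≤ lam i) (n i : ℕ) :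
    ((Finset.Ico n ℓ).filter fun j => i < lam j).card = lamT ℓ lam (i + 1) - n := by
  have h1 := down_eq_range ((Finset.range ℓ).filter fun j => i + 1 ≤ lam j) (by
    intro x hx y hy
    simp only [Finset.mem_filter, Finset.mem_range] at hx ⊢
    exact ⟨by omega, hx.2.trans (hanti _ _ hy.le)⟩)
  change _ = Finset.range (lamT ℓ lam (i + 1)) at h1
  have h2 : ((Finset.Ico n ℓ).filter fun j => i < lam j) = Finset.Ico n (lamT ℓ lam (i + 1)) := by
    ext x
    have h3 := Finset.ext_iff.1 h1 x
    simp only [Finset.mem_filter, Finset.mem_range, Finset.mem_Ico] at h3 ⊢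
    rw [← h3]
    constructor
    · rintro ⟨⟨h4, h5⟩, h6⟩; exact ⟨h4, h5, h6⟩
    · rintro ⟨h4, h5, h6⟩; exact ⟨⟨h4, h5⟩, h6⟩
  rw [h2, Nat.card_Ico]

lemma range_drop (ℓ n : ℕ) : (List.range ℓ).drop n = List.range' n (ℓ - n) := by
  rw [List.range_eq_range', List.drop_range']; simp

lemma aTuple_prod {M : Type*} [CommMonoid M] (ℓ : ℕ) (lam : ℕ → ℕ)
    (hanti : ∀ i j, i ≤ j → lam j ≤ lam i) (a : ℕ → ℂ) (n : ℕ) (g : ℂ → M) :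
    ((aTuple ℓ lam a n).map g).prod =
      ∏ i : Fin (lam 0), g (a i) ^ (lamT ℓ lam (i.1 + 1) - n) := by
  have h1 : ((aTuple ℓ lam a n).map g).prod =
      ∏ i ∈ Finset.Ico n ℓ, ∏ j ∈ Finset.range (lam i), g (a j) := by
    rw [aTuple, range_drop, List.map_flatMap, List.flatMap_def, List.prod_flatten, List.map_map]
    change _ = ((List.range' n (ℓ - n)).map fun i => ∏ j ∈ Finset.range (lam i), g (a j)).prod
    congr 1
    refine List.map_congr_left fun i _ => ?_
    simp only [Function.comp, List.map_map]
    rfl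
  rw [h1, Finset.prod_comm' (t' := Finset.range (lam 0))
    (s' := fun j => (Finset.Ico n ℓ).filter fun i => j < lam i)]
  · rw [Finset.prod_range]
    refine Finset.prod_congr rfl fun i _ => ?_
    rw [Finset.prod_const, lamT_sub _ _ hanti]
  · intro x y
    simp only [Finset.mem_filter, Finset.mem_range]
    constructor
    · rintro ⟨h2, h3⟩; exact ⟨⟨h2, h3⟩, lt_of_lt_of_le h3 (hanti 0 x (Nat.zero_le _))⟩
    · rintro ⟨⟨h2, h3⟩, _⟩; exact ⟨h2, h3⟩

lemma aTuple_length (ℓ : ℕ) (lam : ℕ → ℕ) (a : ℕ → ℂ) (n : ℕ) :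
    (aTuple ℓ lam a n).length = mRem ℓ lam n := by
  rw [aTuple, range_drop, List.length_flatMap]
  change _ = ((List.range' n (ℓ - n)).map fun i => lam i).sum
  simp

lemma mRem_le {d ℓ : ℕ} {lam : ℕ → ℕ} (hpart : IsPartitionOf d ℓ lam) {n : ℕ} (hn : n ≤ ℓ) :
    mRem ℓ lam n + n ≤ d := by
  obtain ⟨_, _, hpos, _, hsum⟩ := hpart
  rw [← hsum, mRem, ← Finset.sum_range_add_sum_Ico lam hn, add_comm]
  refine Nat.add_le_add_right ?_ _
  have := Finset.card_nsmul_le_sum (Finset.range n) lam 1 (fun i hi =>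
    hpos i (by simp at hi; omega))
  simpa using this

lemma sum_lamT {d ℓ : ℕ} {lam : ℕ → ℕ} (hpart : IsPartitionOf d ℓ lam) :
    ∑ i : Fin (lam 0), lamT ℓ lam (i.1 + 1) = d := by
  have h := aTuple_prod (M := Multiplicative ℕ) ℓ lam hpart.2.1 (fun _ => 0) 0
    (fun _ => Multiplicative.ofAdd 1)
  have h2 := congrArg Multiplicative.toAdd h
  simp only [toAdd_prod, toAdd_pow, toAdd_ofAdd, smul_eq_mul, mul_one, Nat.sub_zero] at h2
  rw [← h2, List.map_const', List.prod_replicate, toAdd_pow, toAdd_ofAdd, aTuple_length, mRem,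
    ← hpart.2.2.2.2]
  simp

lemma hcomp_mul (l : List ℂ) :
    (PowerSeries.mk fun k => hcomp k l) *
      ((l.map fun x => (1 - Polynomial.C x * Polynomial.X : ℂ[X])).prod : PowerSeries ℂ) = 1 := by
  induction l with
  | nil =>
    ext k
    cases k <;> simp [hcomp, PowerSeries.coeff_one]
  | cons x l ih =>
    have h1 : (PowerSeries.mk fun k => hcomp k (x :: l)) *
        ((1 - Polynomial.C x * Polynomial.X : ℂ[X]) : PowerSeries ℂ) =
        PowerSeries.mk fun k => hcomp k l := by
      ext k
      rw [Polynomial.coe_sub, Polynomial.coe_mul, Polynomial.coe_one, Polynomial.coe_C,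
        Polynomial.coe_X, mul_sub, mul_one, mul_left_comm, map_sub, PowerSeries.coeff_C_mul]
      cases k with
      | zero => simp [hcomp]
      | succ k => simp [hcomp, PowerSeries.coeff_succ_mul_X]
    rw [List.map_cons, List.prod_cons, Polynomial.coe_mul, ← mul_assoc, h1, ih]

lemma coeff_prod_lin {S : Type*} [CommRing S] {d : ℕ} (J : Finset (Fin d)) (t : Fin d → S) (r : ℕ) :
    (∏ j ∈ J, (1 - Polynomial.C (t j) * Polynomial.X : S[X])).coeff r =
      (-1) ^ r * ∑ s ∈ J.powersetCard r, ∏ j ∈ s, t j := by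
  have h1 : ∀ s : Finset (Fin d), ∏ j ∈ s, (-(Polynomial.C (t j) * Polynomial.X : S[X])) =
      Polynomial.C ((-1) ^ s.card * ∏ j ∈ s, t j) * Polynomial.X ^ s.card := by
    intro s
    rw [Finset.prod_neg, Finset.prod_mul_distrib, Finset.prod_const, map_mul, map_pow, map_neg,
      map_one, map_prod, mul_assoc]
  simp only [sub_eq_add_neg]
  rw [Finset.prod_one_add, Polynomial.finsetSum_coeff]
  simp only [h1, Polynomial.coeff_C_mul_X_pow]
  rw [← Finset.sum_filter, Finset.mul_sum]
  have : J.powerset.filter (fun s => r = s.card) = J.powersetCard r := by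
    ext s; simp [Finset.mem_powersetCard, eq_comm]
  rw [this]
  refine Finset.sum_congr rfl fun s hs => ?_
  rw [(Finset.mem_powersetCard.1 hs).2]

lemma coeff_tanGen {d ℓ : ℕ} {lam : ℕ → ℕ} (a : ℕ → ℂ) {S : Type*} [CommRing S] [Algebra ℂ S]
    (f : MvPolynomial (Fin d) ℂ →ₐ[ℂ] S) (n : ℕ) (J : Finset (Fin d)) (r : ℕ) :
    PowerSeries.coeff r
      (((∏ j ∈ J, (1 - Polynomial.C (f (X j)) * Polynomial.X : S[X]) : S[X]) : PowerSeries S) *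
        PowerSeries.map (algebraMap ℂ S) (PowerSeries.mk fun k => hcomp k (aTuple ℓ lam a n))) =
      (-1) ^ r * f (tanGen d ℓ lam a n J r) := by
  rw [mul_comm, PowerSeries.coeff_mul, Finset.Nat.sum_antidiagonal_eq_sum_range_succ_mk, tanGen, map_sum,
    Finset.mul_sum]
  refine Finset.sum_congr rfl fun k hk => ?_
  have hk' : k ≤ r := by simpa [Nat.lt_succ_iff] using hk
  rw [PowerSeries.coeff_map, PowerSeries.coeff_mk, Polynomial.coeff_coe, coeff_prod_lin, map_mul,
    MvPolynomial.algHom_C, map_mul, elemSym]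
  simp only [map_sum, map_prod, map_pow, map_neg, map_one]
  have : ((-1 : S)) ^ r = (-1) ^ (r - k) * (-1) ^ k := by rw [← pow_add]; congr 1; omega
  have h2 : ((-1 : S)) ^ k * (-1) ^ k = 1 := by rw [← mul_pow]; simp
  rw [this]
  linear_combination (-(algebraMap ℂ S) (hcomp k (aTuple ℓ lam a n)) * (-1) ^ (r - k) *
    ∑ s ∈ J.powersetCard (r - k), ∏ j ∈ s, f (X j)) * h2

theorem tan_iff {d ℓ : ℕ} {lam : ℕ → ℕ} (hpart : IsPartitionOf d ℓ lam) (a : ℕ → ℂ)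
    {S : Type*} [CommRing S] [Algebra ℂ S] (f : MvPolynomial (Fin d) ℂ →ₐ[ℂ] S) :
    (∀ g ∈ tanIdeal d ℓ lam a, f g = 0) ↔
      Tan (fun i : Fin (lam 0) => lamT ℓ lam (i.1 + 1))
        (fun i : Fin (lam 0) => algebraMap ℂ S (a i)) (fun j => f (X j)) := by
  have hkey : ∀ n < ℓ, ∀ J : Finset (Fin d), J.card = d - n →
      (DP (fun i : Fin (lam 0) => lamT ℓ lam (i.1 + 1))
        (fun i : Fin (lam 0) => algebraMap ℂ S (a i)) n ∣
        ∏ j ∈ J, (Polynomial.X - Polynomial.C (f (X j))) ↔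
      ∀ r, d - n - mRem ℓ lam n < r → r ≤ d - n → f (tanGen d ℓ lam a n J r) = 0) := by
    intro n hn J hJ
    have hm := mRem_le hpart hn.le
    set b : Multiset S := (((aTuple ℓ lam a n).map (algebraMap ℂ S) : List S) : Multiset S) with hb
    have hbc : b.card = mRem ℓ lam n := by
      rw [hb, Multiset.coe_card, List.length_map, aTuple_length]
    have := core_iff (J.val.map fun j => f (X j)) b
      (by rw [hbc, Multiset.card_map, Finset.card_val]; omega)
      (PowerSeries.map (algebraMap ℂ S) (PowerSeries.mk fun k => hcomp k (aTuple ℓ lam a n)))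
      (by
        have h1 := congrArg (PowerSeries.map (algebraMap ℂ S)) (hcomp_mul (aTuple ℓ lam a n))
        rw [map_mul, map_one, ← Polynomial.polynomial_map_coe, Polynomial.map_list_prod, List.map_map] at h1
        rw [← h1, hb, Multiset.map_coe, Multiset.prod_coe, List.map_map]
        congr 4
        ext x
        simp)
    rw [hbc, Multiset.card_map, Finset.card_val, hJ] at this
    have hbD : (b.map fun x => (Polynomial.X - Polynomial.C x : S[X])).prod =
        DP (fun i : Fin (lam 0) => lamT ℓ lam (i.1 + 1))
        (fun i : Fin (lam 0) => algebraMap ℂ S (a i)) n := by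
      rw [hb, Multiset.map_coe, Multiset.prod_coe, List.map_map, aTuple_prod _ _ hpart.2.1]
      rfl
    rw [hbD, Multiset.map_map, Multiset.map_map] at this
    refine this.trans ?_
    refine forall_congr' fun r => forall_congr' fun _ => forall_congr' fun _ => ?_
    have h5 := coeff_tanGen (ℓ := ℓ) (lam := lam) a f n J r
    change _ = 0 ↔ _
    rw [show (Multiset.map ((fun x => (1 - Polynomial.C x * Polynomial.X : S[X])) ∘ fun j => f (X j)) J.val).prod =
      ∏ j ∈ J, (1 - Polynomial.C (f (X j)) * Polynomial.X : S[X]) from rfl, h5]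
    constructor
    · intro h6
      have := congrArg (fun x => (-1 : S) ^ r * x) h6
      simpa [← mul_assoc, ← mul_pow] using this
    · intro h6; rw [h6, mul_zero]
  constructor
  · intro h J
    have hJd : J.card ≤ d := by simpa using Finset.card_le_univ J
    by_cases hn : d - J.card < ℓ
    · refine (hkey _ hn J (by omega)).2 fun r h1 h2 => h _ (Ideal.subset_span ?_)
      exact ⟨_, J, r, hn, by omega, h1, h2, rfl⟩
    · have : DP (fun i : Fin (lam 0) => lamT ℓ lam (i.1 + 1))
          (fun i : Fin (lam 0) => algebraMap ℂ S (a i)) (d - J.card) = 1 := by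
        refine Finset.prod_eq_one fun i _ => ?_
        have h1 : lamT ℓ lam (i.1 + 1) ≤ ℓ := by
          refine (Finset.card_filter_le _ _).trans ?_
          simp
        rw [show lamT ℓ lam (i.1 + 1) - (d - J.card) = 0 by omega, pow_zero]
      rw [this]
      exact one_dvd _
  · intro h
    have hle : tanIdeal d ℓ lam a ≤ RingHom.ker f := by
      refine Ideal.span_le.2 ?_
      rintro _ ⟨n, J, r, hn, hJ, h1, h2, rfl⟩
      refine (hkey n hn J hJ).1 ?_ r h1 h2
      have hm := mRem_le hpart hn.le
      have := h J
      rwa [hJ, show d - (d - n) = n by omega] at this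
    exact fun g hg => hle hg

end TanIff

section Deform
open scoped Polynomial

lemma span_push {M V κ : Type*} [AddCommGroup M] [Module ℂ[X] M] [AddCommGroup V] [Module ℂ V]
    (s : ℂ) (χ : M →+ V) (hχ : ∀ (β : ℂ[X]) m, χ (β • m) = β.eval s • χ m)
    (hsurj : Function.Surjective χ) (v : κ → M) (hv : Submodule.span ℂ[X] (Set.range v) = ⊤) :
    ⊤ ≤ Submodule.span ℂ (Set.range fun k => χ (v k)) := by
  rintro y -
  obtain ⟨m, rfl⟩ := hsurj y
  have hm : m ∈ Submodule.span ℂ[X] (Set.range v) := hv ▸ Submodule.mem_top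
  induction hm using Submodule.span_induction with
  | mem x hx =>
    obtain ⟨k, rfl⟩ := hx
    exact Submodule.subset_span ⟨k, rfl⟩
  | zero => simp
  | add x y _ _ hx hy => rw [map_add]; exact add_mem hx hy
  | smul r x _ hx => rw [hχ]; exact Submodule.smul_mem _ _ hx

lemma trace_of_basis {V κ : Type*} [AddCommGroup V] [Module ℂ V] [Fintype κ]
    (v : κ → V) (hli : LinearIndependent ℂ v) (hsp : ⊤ ≤ Submodule.span ℂ (Set.range v))
    (F : V →ₗ[ℂ] V) (K : κ → κ → ℂ) (hK : ∀ k, F (v k) = ∑ k', K k' k • v k') :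
    LinearMap.trace ℂ V F = ∑ k, K k k := by
  classical
  let b := Module.Basis.mk hli hsp
  rw [LinearMap.trace_eq_matrix_trace ℂ b, Matrix.trace]
  refine Finset.sum_congr rfl fun k _ => ?_
  rw [Matrix.diag_apply, LinearMap.toMatrix_apply]
  have hb : ∀ k, b k = v k := fun k => Module.Basis.mk_apply hli hsp k
  rw [hb, hK]
  simp only [← hb, map_sum, map_smul, Module.Basis.repr_self]
  simp [Finsupp.single_apply]

lemma trace_perm {Φ : Type*} [Fintype Φ] (τ : Φ → Φ) :
    LinearMap.trace ℂ (Φ → ℂ) (LinearMap.funLeft ℂ ℂ τ) = (Nat.card {φ // τ φ = φ} : ℂ) := by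
  classical
  rw [LinearMap.trace_eq_matrix_trace ℂ (Pi.basisFun ℂ Φ), Matrix.trace]
  simp only [Matrix.diag_apply, LinearMap.toMatrix_apply, Pi.basisFun_repr, LinearMap.funLeft_apply,
    Pi.basisFun_apply, Pi.single_apply]
  rw [Nat.card_eq_fintype_card, Fintype.card_subtype]
  simp

theorem trace_deform {M R κ Φ : Type*} [AddCommGroup M] [Module ℂ[X] M] [AddCommGroup R]
    [Module ℂ R] [Fintype κ] [Fintype Φ] (v : κ → M)
    (hv : Submodule.span ℂ[X] (Set.range v) = ⊤) (hcard : Fintype.card κ ≤ Fintype.card Φ)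
    (τ : Φ → Φ) (B : ℂ[X]) (hB : B ≠ 0)
    (χ : ℂ → M →+ (Φ → ℂ)) (hχ : ∀ s (β : ℂ[X]) m, χ s (β • m) = β.eval s • χ s m)
    (hχs : ∀ s, B.eval s ≠ 0 → Function.Surjective (χ s))
    (E : M → M) (hE : ∀ s m φ, χ s (E m) φ = χ s m (τ φ))
    (ψ : M →+ R) (hψ : ∀ (β : ℂ[X]) m, ψ (β • m) = β.eval 0 • ψ m)
    (hψs : Function.Surjective ψ) (hψk : ∀ m, ψ m = 0 → ∃ m', m = (Polynomial.X : ℂ[X]) • m')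
    (F : R →ₗ[ℂ] R) (hF : ∀ m, F (ψ m) = ψ (E m)) :
    LinearMap.trace ℂ R F = (Nat.card {φ // τ φ = φ} : ℂ) := by
  have hgen : ∀ β : ℂ[X], (∀ s, B.eval s ≠ 0 → β.eval s = 0) → β = 0 := by
    intro β h
    have : β * B = 0 := by
      refine Polynomial.funext fun s => ?_
      by_cases hs : B.eval s = 0
      · simp [hs]
      · simp [h s hs]
    exact (mul_eq_zero.1 this).resolve_right hB
  have hsp := fun s hs => span_push s (χ s) (hχ s) (hχs s hs) v hv
  have hli : ∀ s, B.eval s ≠ 0 → LinearIndependent ℂ fun k => χ s (v k) := fun s hs =>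
    linearIndependent_of_top_le_span_of_card_le_finrank (hsp s hs) (by simpa using hcard)
  have hex : ∀ m, ∃ β : κ → ℂ[X], ∑ k, β k • v k = m := fun m =>
    (Submodule.mem_span_range_iff_exists_fun ℂ[X]).1 (hv ▸ Submodule.mem_top)
  have hA : ∀ β : κ → ℂ[X], ∑ k, β k • v k = 0 → ∀ k, β k = 0 := by
    intro β h k
    refine hgen _ fun s hs => ?_
    have h1 := congrArg (χ s) h
    simp only [map_sum, hχ, map_zero] at h1
    exact Fintype.linearIndependent_iff.1 (hli s hs) _ h1 k
  have hψli : LinearIndependent ℂ fun k => ψ (v k) := by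
    rw [Fintype.linearIndependent_iff]
    intro α h k
    obtain ⟨m', hm'⟩ := hψk (∑ k, (Polynomial.C (α k)) • v k) (by
      simp only [map_sum, hψ, Polynomial.eval_C]; exact h)
    obtain ⟨β, hβ⟩ := hex m'
    have h1 := hA (fun k => Polynomial.C (α k) - Polynomial.X * β k) (by
      simp only [sub_smul, Finset.sum_sub_distrib, mul_smul, ← Finset.smul_sum]
      rw [hm', hβ, sub_self]) k
    have h2 := congrArg (Polynomial.eval 0) h1
    simpa using h2
  choose K hK using fun k => hex (E (v k))
  have htr : (∑ k, K k k) = Polynomial.C (Nat.card {φ // τ φ = φ} : ℂ) := by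
    rw [← sub_eq_zero]
    refine hgen _ fun s hs => ?_
    rw [Polynomial.eval_sub, Polynomial.eval_C, ← trace_perm τ, sub_eq_zero,
      trace_of_basis _ (hli s hs) (hsp s hs) _ (fun k' k => (K k k').eval s)]
    · rw [Polynomial.eval_finsetSum]
    · intro k
      have h1 := congrArg (χ s) (hK k)
      simp only [map_sum, hχ] at h1
      rw [h1]
      ext φ
      rw [LinearMap.funLeft_apply, hE]
  rw [trace_of_basis _ hψli (span_push 0 ψ hψ hψs v hv) F (fun k' k => (K k k').eval 0)]
  · rw [← Polynomial.eval_finsetSum, htr, Polynomial.eval_C]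
  · intro k
    have h1 := congrArg ψ (hK k)
    simp only [map_sum, hψ] at h1
    rw [h1, hF]

end Deform

section Final
open scoped Polynomial

/-- The universal ideal forcing the divisibility conditions. -/
def univIdeal {A ι : Type*} [CommRing A] [Fintype ι] (d : ℕ) (c : ι → ℕ) (a : ι → A) :
    Ideal (MvPolynomial (Fin d) A) :=
  Ideal.span {g | ∃ (J : Finset (Fin d)) (k : ℕ),
    g = ((∏ j ∈ J, (Polynomial.X - Polynomial.C (X j : MvPolynomial (Fin d) A))) %ₘ
      DP c (fun i => (C (a i) : MvPolynomial (Fin d) A)) (d - J.card)).coeff k}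

lemma univ_kill {A ι S : Type*} [CommRing A] [Fintype ι] [CommRing S] {d : ℕ} {c : ι → ℕ}
    {a : ι → A} (f : MvPolynomial (Fin d) A →+* S)
    (h : Tan c (fun i => f (C (a i))) (fun j => f (X j))) : ∀ g ∈ univIdeal d c a, f g = 0 := by
  have hle : univIdeal d c a ≤ RingHom.ker f := by
    refine Ideal.span_le.2 ?_
    rintro _ ⟨J, k, rfl⟩
    have h1 := h J
    rw [← DP_map f c (fun i => C (a i)), ← prodlin_map f J (fun j => X j),
      ← Polynomial.modByMonic_eq_zero_iff_dvd ((DP_monic _ _ _).map _),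
      ← Polynomial.map_modByMonic _ (DP_monic _ _ _)] at h1
    have h2 := congrArg (fun p => Polynomial.coeff p k) h1
    simp only [Polynomial.coeff_map, Polynomial.coeff_zero] at h2
    exact h2
  exact fun g hg => hle hg

lemma univ_tan {A ι : Type*} [CommRing A] [Fintype ι] (d : ℕ) (c : ι → ℕ) (a : ι → A) :
    Tan c (fun i => Ideal.Quotient.mk (univIdeal d c a) (C (a i)))
      (fun j => Ideal.Quotient.mk (univIdeal d c a) (X j)) := by
  intro J
  rw [← DP_map (Ideal.Quotient.mk (univIdeal d c a)) c (fun i => C (a i)),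
    ← prodlin_map (Ideal.Quotient.mk (univIdeal d c a)) J (fun j => X j),
    ← Polynomial.modByMonic_eq_zero_iff_dvd ((DP_monic _ _ _).map _),
    ← Polynomial.map_modByMonic _ (DP_monic _ _ _)]
  ext k
  rw [Polynomial.coeff_map, Polynomial.coeff_zero, Ideal.Quotient.eq_zero_iff_mem]
  exact Ideal.subset_span ⟨J, k, rfl⟩

lemma point_tan {S ι : Type*} [CommRing S] [Fintype ι] {d : ℕ} {c : ι → ℕ} (a : ι → S)
    (φ : Fill d c) : Tan c a (fun j => a (φ.1 j)) := by
  classical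
  intro J
  rw [← Finset.prod_fiberwise J φ.1, DP]
  refine Finset.prod_dvd_prod_of_dvd _ _ fun i _ => ?_
  have : ∏ j ∈ J.filter (fun j => φ.1 j = i), (Polynomial.X - Polynomial.C (a (φ.1 j))) =
      (Polynomial.X - Polynomial.C (a i)) ^ (J.filter (fun j => φ.1 j = i)).card := by
    rw [Finset.prod_congr rfl (g := fun _ => Polynomial.X - Polynomial.C (a i)), Finset.prod_const]
    intro j hj
    rw [(Finset.mem_filter.1 hj).2]
  rw [this]
  refine pow_dvd_pow _ ?_
  have h1 := φ.2 i
  rw [natCard_fiber] at h1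
  have h2 : (Finset.univ.filter fun j => φ.1 j = i) ⊆ J.filter (fun j => φ.1 j = i) ∪ Jᶜ := by
    intro j hj
    simp only [Finset.mem_filter, Finset.mem_univ, true_and, Finset.mem_union, Finset.mem_compl] at hj ⊢
    by_cases hJ : j ∈ J
    · exact Or.inl ⟨hJ, hj⟩
    · exact Or.inr hJ
  have h3 := (Finset.card_le_card h2).trans (Finset.card_union_le _ _)
  rw [Finset.card_compl, Fintype.card_fin] at h3
  omega

/-- Interpolation at the points of the form `a ∘ φ`. -/
lemma interp {ι : Type*} [Fintype ι] {d : ℕ} {c : ι → ℕ} (a : ι → ℂ) (ha : Function.Injective a)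
    (y : Fill d c → ℂ) : ∃ g : MvPolynomial (Fin d) ℂ,
      ∀ φ : Fill d c, MvPolynomial.eval (fun j => a (φ.1 j)) g = y φ := by
  classical
  have := Fintype.ofFinite (Fill d c)
  let I : Fill d c → MvPolynomial (Fin d) ℂ := fun φ =>
    ∏ j, ∏ i ∈ Finset.univ.erase (φ.1 j), (X j - C (a i))
  have h1 : ∀ φ, MvPolynomial.eval (fun j => a (φ.1 j)) (I φ) ≠ 0 := by
    intro φ
    simp only [I, map_prod, map_sub, MvPolynomial.eval_X, MvPolynomial.eval_C]
    refine Finset.prod_ne_zero_iff.2 fun j _ => Finset.prod_ne_zero_iff.2 fun i hi => ?_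
    exact sub_ne_zero.2 fun h => (Finset.mem_erase.1 hi).1 (ha h).symm
  have h2 : ∀ φ φ', φ' ≠ φ → MvPolynomial.eval (fun j => a (φ'.1 j)) (I φ) = 0 := by
    intro φ φ' hne
    have : ∃ j, φ'.1 j ≠ φ.1 j := by
      by_contra hcon
      push Not at hcon
      exact hne (Subtype.ext (funext hcon))
    obtain ⟨j, hj⟩ := this
    simp only [I, map_prod, map_sub, MvPolynomial.eval_X, MvPolynomial.eval_C]
    refine Finset.prod_eq_zero (Finset.mem_univ j) (Finset.prod_eq_zero
      (Finset.mem_erase.2 ⟨hj, Finset.mem_univ _⟩) (sub_self _))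
  refine ⟨∑ φ, C (y φ / MvPolynomial.eval (fun j => a (φ.1 j)) (I φ)) * I φ, fun φ => ?_⟩
  rw [map_sum, Finset.sum_eq_single φ]
  · rw [map_mul, MvPolynomial.eval_C, div_mul_cancel₀ _ (h1 φ)]
  · intro φ' _ hne
    rw [map_mul, h2 φ' φ hne.symm, mul_zero]
  · simp

/-- Precomposition of fillings with a permutation. -/
def fillPerm {ι : Type*} {d : ℕ} {c : ι → ℕ} (σ : Equiv.Perm (Fin d)) (φ : Fill d c) : Fill d c :=
  ⟨fun j => φ.1 (σ j), fun i => by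
    rw [← φ.2 i]
    exact Nat.card_congr (σ.subtypeEquiv fun j => Iff.rfl)⟩

end Final

section Final2
open scoped Polynomial

theorem special_kill {d ℓ : ℕ} {lam : ℕ → ℕ} (hpart : IsPartitionOf d ℓ lam) (a : ℕ → ℂ)
    {Q : Type*} [CommRing Q] (q : MvPolynomial (Fin d) ℂ[X] →+* Q)
    (hqX : q (C Polynomial.X) = 0)
    (hT : Tan (fun i : Fin (lam 0) => lamT ℓ lam (i.1 + 1))
      (fun i : Fin (lam 0) =>
        q (C (Polynomial.C (a i) + Polynomial.C (i.1 : ℂ) * Polynomial.X)))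
      (fun j => q (X j)))
    (g : MvPolynomial (Fin d) ℂ[X])
    (hg : MvPolynomial.map (Polynomial.evalRingHom 0) g ∈ tanIdeal d ℓ lam a) :
    q g = 0 := by
  let _ : Algebra ℂ Q := RingHom.toAlgebra (q.comp (MvPolynomial.C.comp Polynomial.C))
  let θ : MvPolynomial (Fin d) ℂ →ₐ[ℂ] Q := MvPolynomial.aeval fun j => q (X j)
  have hqC : ∀ z : ℂ, q (C (Polynomial.C z)) = algebraMap ℂ Q z := fun z => rfl
  have hθ := (tan_iff hpart a θ).2 (by
    have h3 : ∀ j, θ (X j) = q (X j) := fun j => by simp [θ]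
    simp only [map_add, map_mul, hqX, mul_zero, add_zero, hqC] at hT
    simp only [h3]
    exact hT)
  have hcomp : θ.toRingHom.comp (MvPolynomial.map (Polynomial.evalRingHom 0)) = q := by
    refine MvPolynomial.ringHom_ext ?_ ?_
    · intro β
      have h4 : β = Polynomial.C (β.eval 0) + Polynomial.X * β.divX := by
        conv_lhs => rw [← Polynomial.X_mul_divX_add β]
        rw [Polynomial.coeff_zero_eq_eval_zero, add_comm]
      conv_rhs => rw [h4]
      simp only [map_add, map_mul, hqX, zero_mul, add_zero, hqC]
      simp [θ]
    · intro j
      simp [θ]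
  rw [← hcomp]
  exact hθ _ hg

theorem special_kill' {d ℓ : ℕ} {lam : ℕ → ℕ} (hpart : IsPartitionOf d ℓ lam) (a : ℕ → ℂ)
    {N : Type*} [CommRing N] (u : MvPolynomial (Fin d) ℂ[X] →+* N)
    (hT : Tan (fun i : Fin (lam 0) => lamT ℓ lam (i.1 + 1))
      (fun i : Fin (lam 0) =>
        u (C (Polynomial.C (a i) + Polynomial.C (i.1 : ℂ) * Polynomial.X)))
      (fun j => u (X j)))
    (g : MvPolynomial (Fin d) ℂ[X])
    (hg : MvPolynomial.map (Polynomial.evalRingHom 0) g ∈ tanIdeal d ℓ lam a) :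
    u (C Polynomial.X) ∣ u g := by
  let V : Ideal N := Ideal.span {u (C Polynomial.X)}
  have h5 := special_kill hpart a ((Ideal.Quotient.mk V).comp u)
    (Ideal.Quotient.eq_zero_iff_mem.2 (Ideal.subset_span rfl))
    (hT.map (Ideal.Quotient.mk V)) g hg
  exact Ideal.mem_span_singleton.1 (Ideal.Quotient.eq_zero_iff_mem.1 h5)

theorem main_trace (d ℓ : ℕ) (lam : ℕ → ℕ) (hpart : IsPartitionOf d ℓ lam)
    (a : ℕ → ℂ) (σ : Equiv.Perm (Fin d))
    (F : TGPAlg d ℓ lam a →ₗ[ℂ] TGPAlg d ℓ lam a)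
    (hF : ∀ g : MvPolynomial (Fin d) ℂ,
      F (Ideal.Quotient.mk (tanIdeal d ℓ lam a) g) =
        Ideal.Quotient.mk (tanIdeal d ℓ lam a) (rename σ g)) :
    LinearMap.trace ℂ (TGPAlg d ℓ lam a) F =
      (Nat.card {φ : Fill d (fun i : Fin (lam 0) => lamT ℓ lam (i.1 + 1)) // fillPerm σ φ = φ} : ℂ) := by
  classical
  set c : Fin (lam 0) → ℕ := fun i => lamT ℓ lam (i.1 + 1) with hc
  let aS : Fin (lam 0) → ℂ[X] := fun i => Polynomial.C (a i) + Polynomial.C (i.1 : ℂ) * Polynomial.X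
  let U := univIdeal d c aS
  have := Fintype.ofFinite (Fill d c)
  obtain ⟨W, hW1, hW2⟩ := span_bound aS d c (sum_lamT hpart) (MvPolynomial (Fin d) ℂ[X] ⧸ U)
    (fun j => Ideal.Quotient.mk U (X j)) (by
      have h1 := congrArg (Subalgebra.map (Ideal.Quotient.mkₐ ℂ[X] U))
        (MvPolynomial.adjoin_range_X (R := ℂ[X]) (σ := Fin d))
      rw [AlgHom.map_adjoin, Algebra.map_top,
        (AlgHom.range_eq_top _).2 (Ideal.Quotient.mkₐ_surjective ℂ[X] U), ← Set.range_comp] at h1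
      exact h1) (univ_tan d c aS)
  -- evaluation at points
  let ev : ℂ → Fill d c → MvPolynomial (Fin d) ℂ[X] →+* ℂ := fun s φ =>
    MvPolynomial.eval₂Hom (Polynomial.evalRingHom s) (fun j => (aS (φ.1 j)).eval s)
  have hev : ∀ s φ, ∀ g ∈ U, ev s φ g = 0 := fun s φ => univ_kill (ev s φ) (by
    have := point_tan (fun i => (aS i).eval s) φ
    simpa [ev] using this)
  let χ : ℂ → (MvPolynomial (Fin d) ℂ[X] ⧸ U) →+* (Fill d c → ℂ) := fun s =>
    RingHom.pi fun φ => Ideal.Quotient.lift U (ev s φ) (hev s φ)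
  have hχmk : ∀ s g φ, χ s (Ideal.Quotient.mk U g) φ = ev s φ g := fun s g φ => rfl
  -- the special fibre
  let f0 : MvPolynomial (Fin d) ℂ[X] →+* TGPAlg d ℓ lam a :=
    (Ideal.Quotient.mk (tanIdeal d ℓ lam a)).comp (MvPolynomial.map (Polynomial.evalRingHom 0))
  have hf0 : ∀ g ∈ U, f0 g = 0 := univ_kill f0 (by
    have := (tan_iff hpart a (Ideal.Quotient.mkₐ ℂ (tanIdeal d ℓ lam a))).1
      (fun g hg => Ideal.Quotient.eq_zero_iff_mem.2 hg)
    have h2 : ∀ i, f0 (C (aS i)) = algebraMap ℂ (TGPAlg d ℓ lam a) (a i) := by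
      intro i
      simp [f0, aS]
      rfl
    simp only [h2]
    have h3 : ∀ j, f0 (X j) = Ideal.Quotient.mkₐ ℂ (tanIdeal d ℓ lam a) (X j) := by
      intro j
      simp [f0]
    simp only [h3]
    exact this)
  let ψ : (MvPolynomial (Fin d) ℂ[X] ⧸ U) →+* TGPAlg d ℓ lam a := Ideal.Quotient.lift U f0 hf0
  let E : (MvPolynomial (Fin d) ℂ[X] ⧸ U) → (MvPolynomial (Fin d) ℂ[X] ⧸ U) := fun m =>
    Ideal.Quotient.mk U (rename σ (Quotient.out m))
  let B : ℂ[X] := ∏ x ∈ (Finset.univ : Finset (Fin (lam 0) × Fin (lam 0))).filter (fun x => x.1 ≠ x.2),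
    (aS x.1 - aS x.2)
  have hB : B ≠ 0 := by
    refine Finset.prod_ne_zero_iff.2 fun x hx h => ?_
    have h1 := congrArg (fun p => Polynomial.coeff p 1) h
    simp [aS, sub_eq_zero] at h1
    simp only [Finset.mem_filter] at hx
    exact hx.2 (Fin.ext h1)
  have hmk : ∀ m : MvPolynomial (Fin d) ℂ[X] ⧸ U, Ideal.Quotient.mk U (Quotient.out m) = m :=
    fun m => Ideal.Quotient.mk_out m
  have hsm : ∀ (β : ℂ[X]) (m : MvPolynomial (Fin d) ℂ[X] ⧸ U),
      β • m = Ideal.Quotient.mk U (C β) * m := by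
    intro β m
    obtain ⟨g, rfl⟩ := Ideal.Quotient.mk_surjective m
    rw [← map_mul, ← MvPolynomial.smul_eq_C_mul]
    rfl
  refine trace_deform (M := MvPolynomial (Fin d) ℂ[X] ⧸ U) (κ := W) (fun w => w.1)
    (by simpa using hW2) (by simpa [Nat.card_eq_fintype_card] using hW1) (fillPerm σ) B hB
    (fun s => (χ s).toAddMonoidHom) ?_ ?_ E ?_ ψ.toAddMonoidHom ?_ ?_ ?_ F ?_
  · intro s β m
    change χ s (β • m) = β.eval s • χ s m
    rw [hsm, map_mul]
    ext φ
    rw [Pi.mul_apply, Pi.smul_apply, hχmk, smul_eq_mul]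
    simp [ev]
  · intro s hs y
    have hinj : Function.Injective fun i => (aS i).eval s := by
      intro i i' hii
      by_contra hne
      apply hs
      rw [Polynomial.eval_prod]
      exact Finset.prod_eq_zero (i := (i, i')) (by simp [hne]) (by
        rw [Polynomial.eval_sub]; exact sub_eq_zero.2 hii)
    obtain ⟨g, hg⟩ := interp (c := c) _ hinj y
    refine ⟨Ideal.Quotient.mk U (MvPolynomial.map Polynomial.C g), ?_⟩
    ext φ
    change χ s (Ideal.Quotient.mk U (MvPolynomial.map Polynomial.C g)) φ = y φ
    rw [hχmk, ← hg φ]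
    simp only [ev, MvPolynomial.coe_eval₂Hom, MvPolynomial.eval₂_map]
    rw [MvPolynomial.eval_eq', MvPolynomial.eval₂_eq']
    simp
  · intro s m φ
    change χ s (E m) φ = χ s m (fillPerm σ φ)
    have h1 : χ s m (fillPerm σ φ) = ev s (fillPerm σ φ) (Quotient.out m) := by
      rw [← hχmk, hmk]
    rw [h1, hχmk]
    simp only [ev, MvPolynomial.coe_eval₂Hom, MvPolynomial.eval₂_rename]
    rfl
  · intro β m
    change ψ (β • m) = β.eval 0 • ψ m
    rw [hsm, map_mul]
    obtain ⟨g, hg⟩ := Ideal.Quotient.mk_surjective (ψ m)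
    rw [← hg]
    have h1 : ψ (Ideal.Quotient.mk U (C β)) =
        Ideal.Quotient.mk (tanIdeal d ℓ lam a) (C (β.eval 0)) := by
      change f0 (C β) = _
      simp [f0]
    rw [h1, ← map_mul, ← MvPolynomial.smul_eq_C_mul]
    rfl
  · intro y
    obtain ⟨g, rfl⟩ := Ideal.Quotient.mk_surjective y
    refine ⟨Ideal.Quotient.mk U (MvPolynomial.map Polynomial.C g), ?_⟩
    change f0 _ = _
    simp only [f0, RingHom.comp_apply, MvPolynomial.map_map]
    congr 1
    have : (Polynomial.evalRingHom (0 : ℂ)).comp Polynomial.C = RingHom.id ℂ := by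
      ext <;> simp
    rw [this, MvPolynomial.map_id]
  · intro m hm
    obtain ⟨g, rfl⟩ := Ideal.Quotient.mk_surjective m
    change f0 g = 0 at hm
    obtain ⟨m', hm'⟩ := special_kill' hpart a (Ideal.Quotient.mk U) (univ_tan d c aS) g
      (Ideal.Quotient.eq_zero_iff_mem.1 hm)
    exact ⟨m', by rw [hsm]; exact hm'⟩
  · intro m
    change F (ψ m) = ψ (E m)
    rw [← hmk m]
    change F (Ideal.Quotient.mk _ _) = ψ (E (Ideal.Quotient.mk U (Quotient.out m)))
    rw [hF, hmk m]
    change _ = f0 _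
    simp only [f0, RingHom.comp_apply, MvPolynomial.map_rename]

end Final2

/-- for any `a` and `σ ∈ S_d`, the trace of the `ℂ`-linear endomorphism of
`R_a(λ)` induced by `t_j ↦ t_{σ(j)}` equals the number of functions
`φ : {1,…,d} → {1,…,p}` with `#φ⁻¹(i) = λ^t_i` for all `i` and `φ∘σ = φ`. -/
theorem deformed_TGP_character (d ℓ : ℕ) (lam : ℕ → ℕ) (hpart : IsPartitionOf d ℓ lam)
    (a : ℕ → ℂ) (σ : Equiv.Perm (Fin d))
    (F : TGPAlg d ℓ lam a →ₗ[ℂ] TGPAlg d ℓ lam a)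
    (hF : ∀ g : MvPolynomial (Fin d) ℂ,
      F (Ideal.Quotient.mk (tanIdeal d ℓ lam a) g) =
        Ideal.Quotient.mk (tanIdeal d ℓ lam a) (rename σ g)) :
    LinearMap.trace ℂ (TGPAlg d ℓ lam a) F =
      (Nat.card {φ : Fin d → Fin (lam 0) //
        (∀ i : Fin (lam 0), Nat.card {j : Fin d // φ j = i} = lamT ℓ lam (i.1 + 1)) ∧
        ∀ j : Fin d, φ (σ j) = φ j} : ℂ) := by
  rw [main_trace d ℓ lam hpart a σ F hF]
  congr 1
  refine Nat.card_congr ?_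
  refine (Equiv.subtypeSubtypeEquivSubtypeInter _
    (fun φ : Fin d → Fin (lam 0) => ∀ j : Fin d, φ (σ j) = φ j)).symm.trans ?_ |>.symm
  refine Equiv.subtypeEquivRight fun φ => ?_
  constructor
  · intro h
    exact Subtype.ext (funext h)
  · intro h j
    exact congrFun (congrArg Subtype.val h) j

end
end

section
/- For every symmetric polynomial s ∈ ℂ[t_1, …, t_d]^{S_d}, the polynomial s − s(a^{(0)}) lies in the deformed Tanisaki ideal ⟨𝒞^a_λ⟩, where s(a^{(0)}) ∈ ℂ denotes the evaluation of s at the d-tuple a^{(0)}. Equivalently, in R_a(λ) every symmetric polynomial in t_1, …, t_d equals the scalar s(a^{(0)}). -/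
open MvPolynomial

noncomputable section

theorem multiset_esymm_cons (x : ℂ) (L : Multiset ℂ) (k : ℕ) :
    (x ::ₘ L).esymm (k + 1) = L.esymm (k + 1) + x * L.esymm k := by
  simp [Multiset.esymm, Multiset.powersetCard_cons, Multiset.map_map, Function.comp_def,
    Multiset.sum_map_mul_left]

theorem hcomp_zero' (L : List ℂ) : hcomp 0 L = 1 := by
  unfold hcomp; rfl

theorem hcomp_mul_esymm (L : List ℂ) :
    (PowerSeries.mk fun k => (-1) ^ k * hcomp k L) *
      (PowerSeries.mk fun k => (L : Multiset ℂ).esymm k) = 1 := by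
  induction L with
  | nil =>
    have h1 : (PowerSeries.mk fun k => (-1) ^ k * hcomp k []) = 1 := by
      ext k
      cases k with
      | zero => simp [hcomp_zero']
      | succ k => rw [PowerSeries.coeff_mk, hcomp]; simp [PowerSeries.coeff_one]
    have h2 : (PowerSeries.mk fun k => (([] : List ℂ) : Multiset ℂ).esymm k) = 1 := by
      ext k
      cases k with
      | zero => simp [Multiset.esymm]
      | succ k => simp [Multiset.esymm, PowerSeries.coeff_one, Multiset.powersetCard_zero_right]
    rw [h1, h2, one_mul]
  | cons x L ih =>
    have h1 : (1 + PowerSeries.C x * PowerSeries.X) *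
        (PowerSeries.mk fun k => (-1) ^ k * hcomp k (x :: L)) =
        PowerSeries.mk fun k => (-1) ^ k * hcomp k L := by
      ext k
      cases k with
      | zero => simp [hcomp_zero', add_mul]
      | succ k =>
        rw [add_mul, one_mul, mul_assoc, map_add, PowerSeries.coeff_C_mul,
          PowerSeries.coeff_succ_X_mul]
        simp only [PowerSeries.coeff_mk]
        rw [hcomp]
        ring
    have h2 : (PowerSeries.mk fun k => ((x :: L : List ℂ) : Multiset ℂ).esymm k) =
        (1 + PowerSeries.C x * PowerSeries.X) *
          (PowerSeries.mk fun k => (L : Multiset ℂ).esymm k) := by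
      ext k
      cases k with
      | zero => simp [Multiset.esymm, add_mul]
      | succ k =>
        rw [add_mul, one_mul, mul_assoc, map_add, PowerSeries.coeff_C_mul,
          PowerSeries.coeff_succ_X_mul]
        simp only [PowerSeries.coeff_mk]
        rw [← Multiset.cons_coe, multiset_esymm_cons]
    rw [h2, ← mul_assoc, mul_comm _ (1 + _), h1, ih]

theorem hcomp_esymm_sum (L : List ℂ) (r : ℕ) (hr : 0 < r) :
    ∑ k ∈ Finset.range (r + 1), (-1) ^ k * hcomp k L * (L : Multiset ℂ).esymm (r - k) = 0 := by
  have h := congrArg (PowerSeries.coeff r) (hcomp_mul_esymm L)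
  rw [PowerSeries.coeff_mul, Finset.Nat.sum_antidiagonal_eq_sum_range_succ_mk] at h
  simpa [PowerSeries.coeff_one, hr.ne'] using h

theorem aTuple_zero_length (ℓ : ℕ) (lam : ℕ → ℕ) (a : ℕ → ℂ) :
    (aTuple ℓ lam a 0).length = ∑ i ∈ Finset.range ℓ, lam i := by
  simp [aTuple, List.length_flatMap, Finset.sum_range]
  rw [← Finset.sum_range (fun i => lam i)]
  rw [Finset.sum_eq_multiset_sum]
  rfl

theorem univ_map_getD (d : ℕ) (L : List ℂ) (h : L.length = d) :
    (Finset.univ.val.map fun i : Fin d => L.getD i.1 0) = (L : Multiset ℂ) := by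
  subst h
  have : (fun i : Fin L.length => L.getD i.1 0) = L.get := by
    funext i; simp
  rw [this, Fin.univ_val_map]
  simp

theorem esymm_mem (d ℓ : ℕ) (lam : ℕ → ℕ) (hpart : IsPartitionOf d ℓ lam)
    (a : ℕ → ℂ) (r : ℕ) (hr : r ≤ d) :
    esymm (Fin d) ℂ r - C ((aTuple ℓ lam a 0 : Multiset ℂ).esymm r) ∈ tanIdeal d ℓ lam a := by
  induction r using Nat.strong_induction_on with
  | _ r ih =>
    rcases Nat.eq_zero_or_pos r with rfl | hpos
    · simp [Multiset.esymm]
    · have hg : tanGen d ℓ lam a 0 Finset.univ r ∈ tanIdeal d ℓ lam a := by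
        apply Ideal.subset_span
        refine ⟨0, Finset.univ, r, hpart.1, by simp, ?_, by simpa using hr, rfl⟩
        have : mRem ℓ lam 0 = d := by
          rw [mRem, ← hpart.2.2.2.2, Finset.range_eq_Ico]
        omega
      set L := aTuple ℓ lam a 0
      have h0 := congrArg (C (σ := Fin d)) (hcomp_esymm_sum L r hpos)
      have key : tanGen d ℓ lam a 0 Finset.univ r =
          ∑ k ∈ Finset.range (r + 1), C ((-1) ^ k * hcomp k L) *
            (esymm (Fin d) ℂ (r - k) - C ((L : Multiset ℂ).esymm (r - k))) := by
        simp only [mul_sub, Finset.sum_sub_distrib, ← C_mul]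
        rw [← map_sum, h0, C_0, sub_zero]
        rfl
      rw [key, Finset.sum_range_succ'] at hg
      have hrest : ∑ k ∈ Finset.range r, C ((-1) ^ (k + 1) * hcomp (k + 1) L) *
            (esymm (Fin d) ℂ (r - (k + 1)) - C ((L : Multiset ℂ).esymm (r - (k + 1)))) ∈
            tanIdeal d ℓ lam a := by
        refine Ideal.sum_mem _ fun k hk => Ideal.mul_mem_left _ _ (ih _ ?_ ?_) <;> omega
      have := (Ideal.add_mem_iff_right _ hrest).1 hg
      simpa [hcomp_zero'] using this

/-- for every symmetric polynomial `s ∈ ℂ[t_1,…,t_d]^{S_d}`, the polynomial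
`s − s(a^{(0)})` lies in the deformed Tanisaki ideal; i.e. in `R_a(λ)` every symmetric
polynomial equals the scalar `s(a^{(0)})`. -/
theorem deformed_TGP_symmetric_eval (d ℓ : ℕ) (lam : ℕ → ℕ) (hpart : IsPartitionOf d ℓ lam)
    (a : ℕ → ℂ) (s : MvPolynomial (Fin d) ℂ) (hs : s.IsSymmetric) :
    s - C (eval (fun i : Fin d => (aTuple ℓ lam a 0).getD i.1 0) s) ∈
      tanIdeal d ℓ lam a := by
  obtain ⟨p, hp⟩ := esymmAlgHom_surjective (σ := Fin d) (R := ℂ) (n := d) (by simp) ⟨s, hs⟩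
  have hp' : aeval (fun i : Fin d => esymm (Fin d) ℂ (i + 1)) p = s := by
    rw [← esymmAlgHom_apply, hp]
  set f : Fin d → ℂ := fun i : Fin d => (aTuple ℓ lam a 0).getD i.1 0 with hf
  rw [← Ideal.Quotient.mk_eq_mk_iff_sub_mem]
  have hL : (aTuple ℓ lam a 0).length = d := by
    rw [aTuple_zero_length, hpart.2.2.2.2]
  have key : ((Ideal.Quotient.mkₐ ℂ (tanIdeal d ℓ lam a)).comp
      (aeval (fun i : Fin d => esymm (Fin d) ℂ (i + 1)))) =
      (((Ideal.Quotient.mkₐ ℂ (tanIdeal d ℓ lam a)).comp (Algebra.ofId ℂ _)).comp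
        (aeval f)).comp (aeval (fun i : Fin d => esymm (Fin d) ℂ (i + 1))) := by
    apply MvPolynomial.algHom_ext
    intro i
    simp only [AlgHom.comp_apply, aeval_X]
    rw [aeval_esymm_eq_multiset_esymm, hf, univ_map_getD d _ hL]
    exact (Ideal.Quotient.mk_eq_mk_iff_sub_mem _ _).2
      (esymm_mem d ℓ lam hpart a (i + 1) (by omega))
  have h := DFunLike.congr_fun key p
  simp only [AlgHom.comp_apply, hp'] at h
  exact h

end
end
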